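/- arXiv:1410.8642 — 4 statements merged into one kernel-verified Lean document; each statement's English description precedes it below -/
import Mathlib

section
/- Osgood's lemma, uniqueness case: let t₀ ≤ T be real numbers, let α : [t₀, T] → [0,∞) be integrable, and let ω : [0,∞) → [0,∞) be continuous and nondecreasing with ω(0) = 0, ω(r) > 0 for r > 0, and ∫₀^1 dr/ω(r) = ∞. If ρ : [t₀, T] → [0,∞) is continuous and satisfies ρ(t) ≤ ∫_{t₀}^t α(s) ω(ρ(s)) ds for every t ∈ [t₀, T], then ρ(t) = 0 for every t ∈ [t₀, T]. -/
open MeasureTheory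

open Set Filter Topology in
/-- If `R` grows from `0` along `A` at a rate controlled by `ω ∘ R`, then `1/ω` is integrable
up to any positive value of `R`. -/
theorem integrableOn_one_div_of_sub_le_mul_sub {a b : ℝ} {ω R A : ℝ → ℝ}
    (hω_cont : ContinuousOn ω (Ici 0)) (hω_mono : MonotoneOn ω (Ici 0))
    (hω_pos : ∀ r, 0 < r → 0 < ω r) (hab : a ≤ b)
    (hR_cont : ContinuousOn R (Icc a b)) (hR_mono : MonotoneOn R (Icc a b)) (hRa : R a = 0)
    (hRb : 0 < R b) (hA_mono : MonotoneOn A (Icc a b))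
    (h : ∀ u ∈ Icc a b, ∀ v ∈ Icc a b, u ≤ v → R v - R u ≤ ω (R v) * (A v - A u)) :
    IntegrableOn (fun r => 1 / ω r) (Ioc 0 (R b)) := by
  set c := R b with hc
  have hpos (n : ℕ) : 0 < c / 2 ^ n := by positivity
  have hle (n : ℕ) : c / 2 ^ n ≤ c := div_le_self hRb.le (one_le_pow₀ one_le_two)
  have hhalf (n : ℕ) : c / 2 ^ (n + 1) = c / 2 ^ n / 2 := by rw [pow_succ, div_div]
  have hcont {x y : ℝ} (hx : 0 < x) : ContinuousOn (fun r => 1 / ω r) (Icc x y) :=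
    continuousOn_const.div (hω_cont.mono fun r hr => hx.le.trans hr.1)
      fun r hr => (hω_pos r (hx.trans_le hr.1)).ne'
  have hint {x y : ℝ} (hx : 0 < x) (hxy : x ≤ y) :
      IntervalIntegrable (fun r => 1 / ω r) volume x y :=
    (hcont hx).intervalIntegrable_of_Icc hxy
  have hex (n : ℕ) : ∃ s ∈ Icc a b, R s = c / 2 ^ n :=
    intermediate_value_Icc hab hR_cont ⟨hRa.trans_le (hpos n).le, hle n⟩
  choose s hs hRs using hex
  have hs_succ (n : ℕ) : s (n + 1) ≤ s n := by
    by_contra! hlt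
    have := hR_mono (hs n) (hs (n + 1)) hlt.le
    rw [hRs, hRs, hhalf] at this
    linarith [hpos n]
  have hstep (n : ℕ) : ∫ r in (c / 2 ^ (n + 1))..(c / 2 ^ n), 1 / ω r ≤
      2 * (A (s (n + 1)) - A (s (n + 2))) := by
    have hωp := hω_pos _ (hpos (n + 1))
    have hxy : c / 2 ^ (n + 1) ≤ c / 2 ^ n := by rw [hhalf]; linarith [hpos n]
    have hbound : ∫ r in (c / 2 ^ (n + 1))..(c / 2 ^ n), 1 / ω r ≤
        ∫ _ in (c / 2 ^ (n + 1))..(c / 2 ^ n), 1 / ω (c / 2 ^ (n + 1)) :=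
      intervalIntegral.integral_mono_on hxy (hint (hpos _) hxy) intervalIntegrable_const
        fun r hr => one_div_le_one_div_of_le hωp
          (hω_mono (hpos _).le ((hpos (n + 1)).le.trans hr.1) hr.1)
    refine hbound.trans ?_
    have hinc := h _ (hs (n + 2)) _ (hs (n + 1)) (hs_succ _)
    rw [hRs, hRs] at hinc
    rw [intervalIntegral.integral_const, smul_eq_mul, mul_one_div, div_le_iff₀ hωp]
    have := hhalf n
    have := hhalf (n + 1)
    linarith
  have hsum (n : ℕ) : ∫ r in (c / 2 ^ n)..c, 1 / ω r ≤ 2 * (A (s 1) - A (s (n + 1))) := by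
    induction n with
    | zero => simp
    | succ n ih =>
      rw [← intervalIntegral.integral_add_adjacent_intervals
        (hint (hpos (n + 1)) (by rw [hhalf]; linarith [hpos n])) (hint (hpos n) (hle n))]
      linarith [hstep n]
  refine integrableOn_Ioc_of_intervalIntegral_norm_bounded_left (l := atTop)
    (a := fun n : ℕ => c / 2 ^ n) (I := 2 * (A (s 1) - A a))
    (fun n => (hint (hpos n) (hle n)).1) ?_ (Eventually.of_forall fun n => ?_)
  · exact tendsto_const_nhds.div_atTop (tendsto_pow_atTop_atTop_of_one_lt one_lt_two)
  · have hnorm : ∫ r in Ioc (c / 2 ^ n) c, ‖1 / ω r‖ = ∫ r in Ioc (c / 2 ^ n) c, 1 / ω r :=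
      setIntegral_congr_fun measurableSet_Ioc fun r hr =>
        Real.norm_of_nonneg (one_div_pos.2 (hω_pos r ((hpos n).trans hr.1))).le
    rw [hnorm, ← intervalIntegral.integral_of_le (hle n)]
    linarith [hsum n, hA_mono (left_mem_Icc.2 hab) (hs (n + 1)) (hs (n + 1)).1]

/-- Local integrability of `1/ω` at `0` does not depend on the right endpoint. -/
theorem integrableOn_one_div_Ioc_zero_of_pos {ω : ℝ → ℝ} {c d : ℝ}
    (hω_cont : ContinuousOn ω (Set.Ici 0)) (hω_pos : ∀ r, 0 < r → 0 < ω r) (hc : 0 < c)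
    (h : IntegrableOn (fun r => 1 / ω r) (Set.Ioc 0 c)) :
    IntegrableOn (fun r => 1 / ω r) (Set.Ioc 0 d) := by
  have hcont : ContinuousOn (fun r => 1 / ω r) (Set.Icc c d) :=
    continuousOn_const.div (hω_cont.mono fun r hr => hc.le.trans hr.1)
      fun r hr => (hω_pos r (hc.trans_le hr.1)).ne'
  refine (h.union hcont.integrableOn_Icc).mono_set fun r hr => ?_
  rcases le_total r c with hrc | hcr
  · exact Or.inl ⟨hr.1, hrc⟩
  · exact Or.inr ⟨hcr, hr.2⟩

/-- Osgood's lemma, uniqueness case: if `ω` is a continuous nondecreasing modulus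
with `ω(0) = 0`, `ω > 0` on `(0,∞)` and `∫₀¹ dr/ω(r) = ∞` (i.e. `1/ω` is not
integrable on `(0,1]`), and a nonnegative continuous `ρ` satisfies
`ρ(t) ≤ ∫_{t₀}^t α(s) ω(ρ(s)) ds` on `[t₀, T]` with `α ≥ 0` integrable,
then `ρ ≡ 0` on `[t₀, T]`. -/
theorem osgood_uniqueness
    (t₀ T : ℝ) (hT : t₀ ≤ T)
    (α : ℝ → ℝ) (hα_int : IntegrableOn α (Set.Icc t₀ T))
    (hα_nonneg : ∀ t ∈ Set.Icc t₀ T, 0 ≤ α t)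
    (ω : ℝ → ℝ)
    (hω_cont : ContinuousOn ω (Set.Ici 0))
    (hω_mono : MonotoneOn ω (Set.Ici 0))
    (hω_nonneg : ∀ r : ℝ, 0 ≤ r → 0 ≤ ω r)
    (hω0 : ω 0 = 0)
    (hω_pos : ∀ r : ℝ, 0 < r → 0 < ω r)
    (hosgood : ¬ IntegrableOn (fun r => 1 / ω r) (Set.Ioc 0 1))
    (ρ : ℝ → ℝ)
    (hρ_cont : ContinuousOn ρ (Set.Icc t₀ T))
    (hρ_nonneg : ∀ t ∈ Set.Icc t₀ T, 0 ≤ ρ t)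
    (hineq : ∀ t ∈ Set.Icc t₀ T, ρ t ≤ ∫ s in t₀..t, α s * ω (ρ s)) :
    ∀ t ∈ Set.Icc t₀ T, ρ t = 0 := by
  intro t ht
  by_contra hne
  have hρt : 0 < ρ t := lt_of_le_of_ne (hρ_nonneg t ht) (Ne.symm hne)
  have hsub : Set.Icc t₀ t ⊆ Set.Icc t₀ T := Set.Icc_subset_Icc_right ht.2
  have hg_int : IntegrableOn (fun s => α s * ω (ρ s)) (Set.Icc t₀ t) :=
    (hα_int.mono_set hsub).mul_continuousOn
      (hω_cont.comp (hρ_cont.mono hsub) fun s hs => hρ_nonneg s (hsub hs)) isCompact_Icc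
  have interval_int {f : ℝ → ℝ} (hf : IntegrableOn f (Set.Icc t₀ t) volume) {u v : ℝ}
      (hu : u ∈ Set.Icc t₀ t) (hv : v ∈ Set.Icc t₀ t) : IntervalIntegrable f volume u v :=
    (hf.mono_set (Set.uIcc_subset_Icc hu hv)).intervalIntegrable
  have sub_eq {f : ℝ → ℝ} (hf : IntegrableOn f (Set.Icc t₀ t) volume) {u v : ℝ}
      (hu : u ∈ Set.Icc t₀ t) (hv : v ∈ Set.Icc t₀ t) :
      (∫ s in t₀..v, f s) - ∫ s in t₀..u, f s = ∫ s in u..v, f s :=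
    intervalIntegral.integral_interval_sub_left
      (interval_int hf (Set.left_mem_Icc.2 ht.1) hv) (interval_int hf (Set.left_mem_Icc.2 ht.1) hu)
  have primitive_mono {f : ℝ → ℝ} (hf : IntegrableOn f (Set.Icc t₀ t) volume)
      (hf0 : ∀ s ∈ Set.Icc t₀ t, 0 ≤ f s) :
      MonotoneOn (fun x => ∫ s in t₀..x, f s) (Set.Icc t₀ t) := fun u hu v hv huv =>
    sub_nonneg.1 <| (sub_eq hf hu hv).symm ▸ intervalIntegral.integral_nonneg huv
      fun s hs => hf0 s ⟨hu.1.trans hs.1, hs.2.trans hv.2⟩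
  have hα0 (s) (hs : s ∈ Set.Icc t₀ t) : 0 ≤ α s := hα_nonneg s (hsub hs)
  have hg0 (s) (hs : s ∈ Set.Icc t₀ t) : 0 ≤ α s * ω (ρ s) :=
    mul_nonneg (hα0 s hs) (hω_nonneg _ (hρ_nonneg s (hsub hs)))
  have hα_int' := hα_int.mono_set hsub
  have hR_mono := primitive_mono hg_int hg0
  have hRt : 0 < ∫ s in t₀..t, α s * ω (ρ s) := hρt.trans_le (hineq t ht)
  refine hosgood (integrableOn_one_div_Ioc_zero_of_pos hω_cont hω_pos hRt
    (integrableOn_one_div_of_sub_le_mul_sub (a := t₀) (b := t)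
      (R := fun x => ∫ s in t₀..x, α s * ω (ρ s)) (A := fun x => ∫ s in t₀..x, α s)
      hω_cont hω_mono hω_pos ht.1 ?_ hR_mono intervalIntegral.integral_same hRt
      (primitive_mono hα_int' hα0) fun u hu v hv huv => ?_))
  · rw [← Set.uIcc_of_le ht.1] at hg_int ⊢
    exact intervalIntegral.continuousOn_primitive_interval hg_int
  · rw [sub_eq hg_int hu hv, sub_eq hα_int' hu hv, mul_comm, ← intervalIntegral.integral_mul_const]
    refine intervalIntegral.integral_mono_on huv (interval_int hg_int hu hv)
      ((interval_int hα_int' hu hv).mul_const _) fun s hs => ?_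
    have hst : s ∈ Set.Icc t₀ t := ⟨hu.1.trans hs.1, hs.2.trans hv.2⟩
    have hρs := hρ_nonneg s (hsub hst)
    have hρR : ρ s ≤ ∫ s in t₀..v, α s * ω (ρ s) :=
      (hineq s (hsub hst)).trans (hR_mono hst hv hs.2)
    exact mul_le_mul_of_nonneg_left (hω_mono hρs (hρs.trans hρR) hρR) (hα0 s hst)
end

section
/- Osgood's lemma, quantitative case: let t₀ ≤ T be real numbers, let α : [t₀, T] → [0,∞) be integrable, let ω : [0,∞) → [0,∞) be continuous and nondecreasing with ω(0) = 0, ω(r) > 0 for r > 0, and ∫₀^1 dr/ω(r) = ∞, and let a > 0. Define Ω(x) := ∫_x^1 dr/ω(r) for x > 0. If ρ : [t₀, T] → [0,∞) is continuous and satisfies ρ(t) ≤ a + ∫_{t₀}^t α(s) ω(ρ(s)) ds for every t ∈ [t₀, T], then for every t ∈ [t₀, T] with ρ(t) > 0 one has Ω(a) − Ω(ρ(t)) ≤ ∫_{t₀}^t α(s) ds. -/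
open MeasureTheory

lemma intervalIntegrable_one_div_of_pos {ω : ℝ → ℝ} (hω_cont : ContinuousOn ω (Set.Ici 0))
    (hω_pos : ∀ r : ℝ, 0 < r → 0 < ω r) {x y : ℝ} (hx : 0 < x) (hy : 0 < y) :
    IntervalIntegrable (fun r => 1 / ω r) volume x y := by
  have hpos : ∀ r ∈ Set.uIcc x y, 0 < r := fun r hr => (lt_min hx hy).trans_le hr.1
  refine ContinuousOn.intervalIntegrable (continuousOn_const.div
    (hω_cont.mono fun r hr => (hpos r hr).le) fun r hr => (hω_pos r (hpos r hr)).ne')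

lemma integral_one_div_le_of_monotoneOn {ω : ℝ → ℝ} (hω_cont : ContinuousOn ω (Set.Ici 0))
    (hω_mono : MonotoneOn ω (Set.Ici 0)) (hω_pos : ∀ r : ℝ, 0 < r → 0 < ω r)
    {x y : ℝ} (hx : 0 < x) (hxy : x ≤ y) :
    ∫ r in x..y, 1 / ω r ≤ (y - x) / ω x := by
  calc ∫ r in x..y, 1 / ω r ≤ ∫ _ in x..y, 1 / ω x :=
        intervalIntegral.integral_mono_on hxy
          (intervalIntegrable_one_div_of_pos hω_cont hω_pos hx (hx.trans_le hxy))
          intervalIntegrable_const fun r hr =>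
            one_div_le_one_div_of_le (hω_pos x hx) (hω_mono hx.le (hx.le.trans hr.1) hr.1)
    _ = (y - x) / ω x := by simp [div_eq_mul_inv]

/-- If `R` is a continuous monotone function whose increments are controlled by
`ω (R y) * (A y - A x)`, then `∫ r in R t₀..R t, 1 / ω r` is controlled by `A t - A t₀`. -/
lemma integral_one_div_le_sub_of_increment_le {ω R A : ℝ → ℝ} {t₀ t : ℝ} (ht : t₀ ≤ t)
    (hω_cont : ContinuousOn ω (Set.Ici 0)) (hω_mono : MonotoneOn ω (Set.Ici 0))
    (hω_pos : ∀ r : ℝ, 0 < r → 0 < ω r)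
    (hR_cont : ContinuousOn R (Set.Icc t₀ t)) (hR_mono : MonotoneOn R (Set.Icc t₀ t))
    (hR_pos : 0 < R t₀)
    (hA_cont : ContinuousOn A (Set.Icc t₀ t)) (hA_mono : MonotoneOn A (Set.Icc t₀ t))
    (hRA : ∀ x ∈ Set.Icc t₀ t, ∀ y ∈ Set.Icc t₀ t, x ≤ y →
      R y - R x ≤ ω (R y) * (A y - A x)) :
    ∫ r in R t₀..R t, 1 / ω r ≤ A t - A t₀ := by
  have hpos : ∀ x ∈ Set.Icc t₀ t, 0 < R x := fun x hx =>
    hR_pos.trans_le (hR_mono (Set.left_mem_Icc.2 ht) hx hx.1)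
  have hint : ∀ x ∈ Set.Icc t₀ t, ∀ y ∈ Set.Icc t₀ t,
      IntervalIntegrable (fun r => 1 / ω r) volume (R x) (R y) := fun x hx y hy =>
    intervalIntegrable_one_div_of_pos hω_cont hω_pos (hpos x hx) (hpos y hy)
  have hωR : ContinuousOn (fun x => ω (R x)) (Set.Icc t₀ t) :=
    hω_cont.comp hR_cont fun x hx => (hpos x hx).le
  have hG : ContinuousOn (fun x => ∫ r in R t₀..R x, 1 / ω r) (Set.Icc t₀ t) := by
    have hprim := intervalIntegral.continuousOn_primitive_interval'
      (hint t₀ (Set.left_mem_Icc.2 ht) t (Set.right_mem_Icc.2 ht)) Set.left_mem_uIcc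
    refine hprim.comp hR_cont fun x hx => ?_
    rw [Set.uIcc_of_le (hR_mono (Set.left_mem_Icc.2 ht) (Set.right_mem_Icc.2 ht) ht)]
    exact ⟨hR_mono (Set.left_mem_Icc.2 ht) hx hx.1, hR_mono hx (Set.right_mem_Icc.2 ht) hx.2⟩
  have key : ∀ c : ℝ, 1 < c → ∫ r in R t₀..R t, 1 / ω r ≤ c * (A t - A t₀) := by
    intro c hc
    let S : Set ℝ := {x | ∫ r in R t₀..R x, 1 / ω r ≤ c * (A x - A t₀)}
    have hS : IsClosed (S ∩ Set.Icc t₀ t) := by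
      have := isClosed_Icc.isClosed_le hG
        (continuousOn_const.mul (hA_cont.sub continuousOn_const) :
          ContinuousOn (fun x => c * (A x - A t₀)) (Set.Icc t₀ t))
      rw [Set.inter_comm]
      exact this
    refine hS.mem_of_ge_of_forall_exists_gt (by simp [S]) ht ?_
    rintro x ⟨hxS, hx⟩
    have hxI : x ∈ Set.Icc t₀ t := Set.Ico_subset_Icc_self hx
    have hωx := hω_pos _ (hpos x hxI)
    have hlt : ∀ᶠ y in nhdsWithin x (Set.Icc t₀ t), ω (R y) < c * ω (R x) :=
      (hωR x hxI).eventually_lt_const (by nlinarith)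
    have hle : nhdsWithin x (Set.Ioc x t) ≤ nhdsWithin x (Set.Icc t₀ t) :=
      nhdsWithin_mono _ fun y hy => ⟨hx.1.trans hy.1.le, hy.2⟩
    have : (nhdsWithin x (Set.Ioc x t)).NeBot := by
      rw [nhdsWithin_Ioc_eq_nhdsGT hx.2]
      infer_instance
    obtain ⟨y, hy, hyx⟩ := ((hlt.filter_mono hle).and self_mem_nhdsWithin).exists
    refine ⟨y, ?_, hyx⟩
    have hyI : y ∈ Set.Icc t₀ t := ⟨hx.1.trans hyx.1.le, hyx.2⟩
    have hAxy : 0 ≤ A y - A x := sub_nonneg.2 (hA_mono hxI hyI hyx.1.le)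
    have hstep : ∫ r in R x..R y, 1 / ω r ≤ c * (A y - A x) := by
      refine (integral_one_div_le_of_monotoneOn hω_cont hω_mono hω_pos (hpos x hxI)
        (hR_mono hxI hyI hyx.1.le)).trans ?_
      rw [div_le_iff₀ hωx]
      calc R y - R x ≤ ω (R y) * (A y - A x) := hRA x hxI y hyI hyx.1.le
        _ ≤ c * ω (R x) * (A y - A x) := by gcongr
        _ = c * (A y - A x) * ω (R x) := by ring
    have hadd := intervalIntegral.integral_add_adjacent_intervals
      (hint t₀ (Set.left_mem_Icc.2 ht) x hxI) (hint x hxI y hyI)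
    simp only [S, Set.mem_ofPred_eq] at hxS ⊢
    linarith
  have hlim : Filter.Tendsto (fun c : ℝ => c * (A t - A t₀)) (nhdsWithin 1 (Set.Ioi 1))
      (nhds (1 * (A t - A t₀))) :=
    ((continuous_id.mul continuous_const).tendsto 1).mono_left nhdsWithin_le_nhds
  rw [one_mul] at hlim
  exact ge_of_tendsto hlim (Filter.eventually_of_mem self_mem_nhdsWithin key)

/-- Osgood's lemma, quantitative case: with `Ω(x) := ∫_x^1 dr/ω(r)`, if
`ρ(t) ≤ a + ∫_{t₀}^t α(s) ω(ρ(s)) ds` on `[t₀, T]` with `a > 0`, then wherever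
`ρ(t) > 0` one has `Ω(a) − Ω(ρ(t)) ≤ ∫_{t₀}^t α(s) ds`. -/
theorem osgood_quantitative
    (t₀ T : ℝ) (hT : t₀ ≤ T)
    (α : ℝ → ℝ) (hα_int : IntegrableOn α (Set.Icc t₀ T))
    (hα_nonneg : ∀ t ∈ Set.Icc t₀ T, 0 ≤ α t)
    (ω : ℝ → ℝ)
    (hω_cont : ContinuousOn ω (Set.Ici 0))
    (hω_mono : MonotoneOn ω (Set.Ici 0))
    (hω_nonneg : ∀ r : ℝ, 0 ≤ r → 0 ≤ ω r)
    (hω0 : ω 0 = 0)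
    (hω_pos : ∀ r : ℝ, 0 < r → 0 < ω r)
    (hosgood : ¬ IntegrableOn (fun r => 1 / ω r) (Set.Ioc 0 1))
    (a : ℝ) (ha : 0 < a)
    (ρ : ℝ → ℝ)
    (hρ_cont : ContinuousOn ρ (Set.Icc t₀ T))
    (hρ_nonneg : ∀ t ∈ Set.Icc t₀ T, 0 ≤ ρ t)
    (hineq : ∀ t ∈ Set.Icc t₀ T, ρ t ≤ a + ∫ s in t₀..t, α s * ω (ρ s)) :
    ∀ t ∈ Set.Icc t₀ T, 0 < ρ t →
      (∫ r in a..1, 1 / ω r) - (∫ r in (ρ t)..1, 1 / ω r) ≤ ∫ s in t₀..t, α s := by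
  intro t ht hρt
  have hsub : Set.Icc t₀ t ⊆ Set.Icc t₀ T := Set.Icc_subset_Icc_right ht.2
  have hα : IntegrableOn α (Set.Icc t₀ t) := hα_int.mono_set hsub
  have hωρ : ContinuousOn (fun s => ω (ρ s)) (Set.Icc t₀ t) :=
    hω_cont.comp (hρ_cont.mono hsub) fun s hs => hρ_nonneg s (hsub hs)
  have hβ : IntegrableOn (fun s => α s * ω (ρ s)) (Set.Icc t₀ t) :=
    hα.mul_continuousOn hωρ isCompact_Icc
  have hii : ∀ {f : ℝ → ℝ}, IntegrableOn f (Set.Icc t₀ t) → ∀ x ∈ Set.Icc t₀ t,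
      ∀ y ∈ Set.Icc t₀ t, IntervalIntegrable f volume x y := fun hf x hx y hy =>
    (hf.mono_set (Set.uIcc_subset_Icc hx hy)).intervalIntegrable
  have h₀ : t₀ ∈ Set.Icc t₀ t := Set.left_mem_Icc.2 ht.1
  have h₁ : t ∈ Set.Icc t₀ t := Set.right_mem_Icc.2 ht.1
  have hincr : ∀ {f : ℝ → ℝ}, IntegrableOn f (Set.Icc t₀ t) → ∀ x ∈ Set.Icc t₀ t,
      ∀ y ∈ Set.Icc t₀ t, (∫ s in t₀..y, f s) - ∫ s in t₀..x, f s = ∫ s in x..y, f s :=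
    fun hf x hx y hy =>
      intervalIntegral.integral_interval_sub_left (hii hf _ h₀ y hy) (hii hf _ h₀ x hx)
  have hmono : ∀ {f : ℝ → ℝ}, IntegrableOn f (Set.Icc t₀ t) →
      (∀ s ∈ Set.Icc t₀ t, 0 ≤ f s) → MonotoneOn (fun x => ∫ s in t₀..x, f s) (Set.Icc t₀ t) :=
    fun hf hf0 x hx y hy hxy => by
      rw [← sub_nonneg, hincr hf x hx y hy]
      exact intervalIntegral.integral_nonneg hxy fun s hs =>
        hf0 s ⟨hx.1.trans hs.1, hs.2.trans hy.2⟩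
  have hcont : ∀ {f : ℝ → ℝ}, IntegrableOn f (Set.Icc t₀ t) →
      ContinuousOn (fun x => ∫ s in t₀..x, f s) (Set.Icc t₀ t) := fun hf => by
    have := intervalIntegral.continuousOn_primitive_interval' (hii hf _ h₀ _ h₁)
      Set.left_mem_uIcc
    rwa [Set.uIcc_of_le ht.1] at this
  have hβ_nonneg : ∀ s ∈ Set.Icc t₀ t, 0 ≤ α s * ω (ρ s) := fun s hs =>
    mul_nonneg (hα_nonneg s (hsub hs)) (hω_nonneg _ (hρ_nonneg s (hsub hs)))
  let R : ℝ → ℝ := fun x => a + ∫ s in t₀..x, α s * ω (ρ s)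
  have hR₀ : R t₀ = a := by simp [R]
  have hR_mono : MonotoneOn R (Set.Icc t₀ t) := fun x hx y hy hxy =>
    add_le_add_right (hmono hβ hβ_nonneg hx hy hxy) a
  have haR : a ≤ R t := hR₀ ▸ hR_mono h₀ h₁ ht.1
  have hmain : ∫ r in R t₀..R t, 1 / ω r ≤ (∫ s in t₀..t, α s) - ∫ s in t₀..t₀, α s := by
    refine integral_one_div_le_sub_of_increment_le (A := fun x => ∫ s in t₀..x, α s) ht.1 hω_cont
      hω_mono hω_pos (continuousOn_const.add (hcont hβ)) hR_mono (hR₀ ▸ ha) (hcont hα)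
      (hmono hα fun s hs => hα_nonneg s (hsub hs)) fun x hx y hy hxy => ?_
    have hR_sub : R y - R x = ∫ s in x..y, α s * ω (ρ s) := by
      rw [← hincr hβ x hx y hy]
      simp [R]
    rw [hR_sub, hincr hα x hx y hy, ← intervalIntegral.integral_const_mul]
    refine intervalIntegral.integral_mono_on hxy (hii hβ x hx y hy)
      ((hii hα x hx y hy).const_mul _) fun s hs => ?_
    have hsI : s ∈ Set.Icc t₀ t := ⟨hx.1.trans hs.1, hs.2.trans hy.2⟩
    have hρR : ρ s ≤ R y := (hineq s (hsub hsI)).trans (hR_mono hsI hy hs.2)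
    have hρs := hρ_nonneg s (hsub hsI)
    rw [mul_comm]
    exact mul_le_mul_of_nonneg_right (hω_mono hρs (hρs.trans hρR) hρR) (hα_nonneg s (hsub hsI))
  rw [hR₀, intervalIntegral.integral_same, sub_zero] at hmain
  have hint : ∀ {x y : ℝ}, 0 < x → 0 < y → IntervalIntegrable (fun r => 1 / ω r) volume x y :=
    intervalIntegrable_one_div_of_pos hω_cont hω_pos
  have hRt : 0 < R t := ha.trans_le haR
  have hnonneg : 0 ≤ ∫ r in ρ t..R t, 1 / ω r :=
    intervalIntegral.integral_nonneg (hineq t ht) fun r hr =>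
      (one_div_pos.2 (hω_pos r (hρt.trans_le hr.1))).le
  have hsplit := intervalIntegral.integral_add_adjacent_intervals (hint ha hρt) (hint hρt hRt)
  have hsplit₁ := intervalIntegral.integral_add_adjacent_intervals (hint ha hρt)
    (hint hρt one_pos)
  linarith
end

section
/- Bernstein inequality, annulus case: let d ≥ 1, α ≥ 0, 1 ≤ p ≤ q ≤ ∞, and 0 < K₁ ≤ K₂. Then there exist constants C₁, C₂ > 0 (depending only on d, α, p, q, K₁, K₂) such that for every j ∈ ℤ and every Schwartz function u : ℝ^d → ℂ whose Fourier transform 𝓕u is supported in the annulus {ξ ∈ ℝ^d : K₁ 2^j ≤ |ξ| ≤ K₂ 2^j}, one has C₁ 2^{2αj} ‖u‖_{L^q} ≤ ‖(−Δ)^α u‖_{L^q} and ‖(−Δ)^α u‖_{L^q} ≤ C₂ 2^{2αj + jd(1/p − 1/q)} ‖u‖_{L^p}. -/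
open MeasureTheory
open scoped ENNReal FourierTransform

section Young

variable {G : Type*} [AddCommGroup G] [MeasurableSpace G] [MeasurableAdd₂ G] [MeasurableNeg G]
  {μ : Measure G} [μ.IsAddLeftInvariant] [μ.IsNegInvariant]

/-- Hölder's inequality for a convolution, with the kernel used as a weight. -/
theorem lintegral_conv_rpow_le {K F : G → ℝ≥0∞} (hK : Measurable K) (hF : Measurable F)
    {s : ℝ} (hs : 1 ≤ s) (x : G) :
    (∫⁻ y, K (x - y) * F y ∂μ) ^ s
      ≤ (∫⁻ y, K y ∂μ) ^ (s - 1) * ∫⁻ y, K (x - y) * F y ^ s ∂μ := by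
  have hs0 : 0 < s := by linarith
  have hsub : 0 ≤ 1 - 1 / s := by
    rw [sub_nonneg, div_le_one hs0]; exact hs
  have hKx : Measurable fun y => K (x - y) := hK.comp (measurable_const.sub measurable_id)
  have h := ENNReal.lintegral_mul_norm_pow_le (μ := μ) (f := fun y => K (x - y))
    (g := fun y => K (x - y) * F y ^ s) hKx.aemeasurable
    (hKx.mul (hF.pow_const s)).aemeasurable hsub (by positivity : 0 ≤ 1 / s) (by ring)
  have e : ∀ y, K (x - y) ^ (1 - 1 / s) * (K (x - y) * F y ^ s) ^ (1 / s) = K (x - y) * F y := by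
    intro y
    rw [ENNReal.mul_rpow_of_nonneg _ _ (by positivity), ← mul_assoc,
      ← ENNReal.rpow_add_of_nonneg _ _ hsub (by positivity), ← ENNReal.rpow_mul,
      mul_one_div_cancel hs0.ne']
    simp
  simp_rw [e] at h
  rw [lintegral_sub_left_eq_self] at h
  calc _ ≤ _ := ENNReal.rpow_le_rpow h hs0.le
    _ = _ := by
      rw [ENNReal.mul_rpow_of_nonneg _ _ hs0.le, ← ENNReal.rpow_mul, ← ENNReal.rpow_mul,
        one_div_mul_cancel hs0.ne', ENNReal.rpow_one]
      congr 2
      field_simp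

/-- Young's inequality `‖K * f‖_{L^p} ≤ ‖K‖_{L^1} ‖f‖_{L^p}` in integrated form. -/
theorem lintegral_conv_rpow_lintegral_le [SFinite μ] {K F : G → ℝ≥0∞} (hK : Measurable K) (hF : Measurable F)
    {s : ℝ} (hs : 1 ≤ s) :
    ∫⁻ x, (∫⁻ y, K (x - y) * F y ∂μ) ^ s ∂μ ≤ (∫⁻ y, K y ∂μ) ^ s * ∫⁻ y, F y ^ s ∂μ := by
  have hm : Measurable fun z : G × G => K (z.1 - z.2) * F z.2 ^ s :=
    (hK.comp (measurable_fst.sub measurable_snd)).mul ((hF.pow_const s).comp measurable_snd)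
  calc _ ≤ ∫⁻ x, (∫⁻ y, K y ∂μ) ^ (s - 1) * ∫⁻ y, K (x - y) * F y ^ s ∂μ ∂μ :=
        lintegral_mono fun x => lintegral_conv_rpow_le hK hF hs x
    _ = (∫⁻ y, K y ∂μ) ^ (s - 1) * ∫⁻ x, ∫⁻ y, K (x - y) * F y ^ s ∂μ ∂μ :=
        lintegral_const_mul _ hm.lintegral_prod_right'
    _ = (∫⁻ y, K y ∂μ) ^ (s - 1) * ∫⁻ y, (∫⁻ x, K x ∂μ) * F y ^ s ∂μ := by
        rw [lintegral_lintegral_swap hm.aemeasurable]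
        congr 2 with y
        rw [lintegral_mul_const _ (f := fun x => K (x - y))
          (hK.comp (measurable_id.sub measurable_const)), lintegral_sub_right_eq_self]
    _ = _ := by
        rw [lintegral_const_mul _ (hF.pow_const s), ← mul_assoc]
        congr 1
        nth_rewrite 2 [← ENNReal.rpow_one (∫⁻ x, K x ∂μ)]
        rw [← ENNReal.rpow_add_of_nonneg _ _ (by linarith) zero_le_one]
        congr 1; ring

/-- A form of Young's convolution inequality, for a kernel controlled in `L^1` and `L^∞`. -/
theorem eLpNorm_le_of_enorm_le_lintegral_conv [SFinite μ] {F₁ F₂ : Type*} [NormedAddCommGroup F₁]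
    [NormedAddCommGroup F₂] {K : G → ℝ≥0∞} {f : G → F₁} {g : G → F₂}
    (hK : Measurable K) (hf : Measurable fun x => ‖f x‖ₑ)
    (hg : ∀ x, ‖g x‖ₑ ≤ ∫⁻ y, K (x - y) * ‖f y‖ₑ ∂μ)
    {A B : ℝ≥0∞} (hA0 : A ≠ 0) (hA : A ≠ ∞)
    (hKA : ∫⁻ y, K y ∂μ ≤ A) (hKB : ∀ x, K x ≤ B)
    {p q : ℝ≥0∞} (hp : 1 ≤ p) (hpq : p ≤ q) :
    eLpNorm g q μ ≤ A ^ (1 - (p.toReal⁻¹ - q.toReal⁻¹)) * B ^ (p.toReal⁻¹ - q.toReal⁻¹)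
      * eLpNorm f p μ := by
  rcases eq_or_ne p ∞ with rfl | hptop
  · obtain rfl : q = ∞ := top_le_iff.mp hpq
    simp only [ENNReal.toReal_top, inv_zero, sub_zero, ENNReal.rpow_one, ENNReal.rpow_zero, mul_one,
      eLpNorm_exponent_top]
    refine eLpNormEssSup_le_of_ae_enorm_bound (Filter.Eventually.of_forall fun x => ?_)
    calc _ ≤ _ := hg x
      _ ≤ ∫⁻ y, K (x - y) * eLpNormEssSup f μ ∂μ := by
        refine lintegral_mono_ae ?_
        filter_upwards [enorm_ae_le_eLpNormEssSup f μ] with y hy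
        gcongr
      _ = (∫⁻ y, K y ∂μ) * eLpNormEssSup f μ := by
        rw [lintegral_mul_const _ (f := fun y => K (x - y))
          (hK.comp (measurable_const.sub measurable_id)), lintegral_sub_left_eq_self]
      _ ≤ _ := by gcongr
  set s := p.toReal with hs_def
  have hp0 : p ≠ 0 := (zero_lt_one.trans_le hp).ne'
  have hs : 1 ≤ s := by
    rw [hs_def, ← ENNReal.toReal_one]; exact ENNReal.toReal_mono hptop hp
  have hs0 : 0 < s := by linarith
  set N := eLpNorm f p μ with hN
  have hNs : ∫⁻ y, ‖f y‖ₑ ^ s ∂μ = N ^ s := by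
    rw [hN, eLpNorm_eq_lintegral_rpow_enorm_toReal hp0 hptop, ← ENNReal.rpow_mul,
      one_div_mul_cancel hs0.ne', ENNReal.rpow_one]
  have hsup : ∀ x, ‖g x‖ₑ ≤ A ^ (1 - s⁻¹) * B ^ s⁻¹ * N := by
    intro x
    have h1 : ‖g x‖ₑ ^ s ≤ A ^ (s - 1) * (B * N ^ s) := by
      calc _ ≤ _ := ENNReal.rpow_le_rpow (hg x) hs0.le
        _ ≤ _ := lintegral_conv_rpow_le hK hf hs x
        _ ≤ A ^ (s - 1) * ∫⁻ y, B * ‖f y‖ₑ ^ s ∂μ := by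
          gcongr
          exact hKB _
        _ = _ := by rw [lintegral_const_mul _ (hf.pow_const s), hNs]
    rw [← ENNReal.rpow_le_rpow_iff hs0]
    refine h1.trans_eq ?_
    rw [ENNReal.mul_rpow_of_nonneg _ _ hs0.le, ENNReal.mul_rpow_of_nonneg _ _ hs0.le,
      ← ENNReal.rpow_mul, ← ENNReal.rpow_mul, inv_mul_cancel₀ hs0.ne', ENNReal.rpow_one, mul_assoc]
    congr 2
    field_simp
  rcases eq_or_ne q ∞ with rfl | hqtop
  · simp only [ENNReal.toReal_top, inv_zero, sub_zero, eLpNorm_exponent_top]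
    exact eLpNormEssSup_le_of_ae_enorm_bound (Filter.Eventually.of_forall hsup)
  set t := q.toReal with ht_def
  have hst : s ≤ t := ENNReal.toReal_mono hqtop hpq
  have ht0 : 0 < t := hs0.trans_le hst
  have hq0 : q ≠ 0 := (zero_lt_one.trans_le (hp.trans hpq)).ne'
  have hts : 0 ≤ t - s := sub_nonneg.2 hst
  rw [eLpNorm_eq_lintegral_rpow_enorm_toReal hq0 hqtop, ← ht_def,
    ← ENNReal.rpow_le_rpow_iff ht0, ← ENNReal.rpow_mul, one_div_mul_cancel ht0.ne',
    ENNReal.rpow_one]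
  have hLs : ∫⁻ x, (∫⁻ y, K (x - y) * ‖f y‖ₑ ∂μ) ^ s ∂μ ≤ A ^ s * N ^ s := by
    refine (lintegral_conv_rpow_lintegral_le hK hf hs).trans ?_
    rw [hNs]
    gcongr
  have hm : Measurable fun z : G × G => K (z.1 - z.2) * ‖f z.2‖ₑ :=
    (hK.comp (measurable_fst.sub measurable_snd)).mul (hf.comp measurable_snd)
  calc ∫⁻ x, ‖g x‖ₑ ^ t ∂μ
      ≤ ∫⁻ x, (A ^ (1 - s⁻¹) * B ^ s⁻¹ * N) ^ (t - s)
          * (∫⁻ y, K (x - y) * ‖f y‖ₑ ∂μ) ^ s ∂μ := by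
        refine lintegral_mono fun x => ?_
        have : ‖g x‖ₑ ^ t = ‖g x‖ₑ ^ (t - s) * ‖g x‖ₑ ^ s := by
          rw [← ENNReal.rpow_add_of_nonneg _ _ hts hs0.le, sub_add_cancel]
        rw [this]
        gcongr
        · exact hsup x
        · exact hg x
    _ = (A ^ (1 - s⁻¹) * B ^ s⁻¹ * N) ^ (t - s)
          * ∫⁻ x, (∫⁻ y, K (x - y) * ‖f y‖ₑ ∂μ) ^ s ∂μ :=
        lintegral_const_mul _ (hm.lintegral_prod_right'.pow_const s)
    _ ≤ (A ^ (1 - s⁻¹) * B ^ s⁻¹ * N) ^ (t - s) * (A ^ s * N ^ s) := by gcongr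
    _ = (A ^ ((1 - s⁻¹) * (t - s)) * A ^ s) * B ^ (s⁻¹ * (t - s)) * (N ^ (t - s) * N ^ s) := by
        rw [ENNReal.mul_rpow_of_nonneg _ _ hts, ENNReal.mul_rpow_of_nonneg _ _ hts,
          ← ENNReal.rpow_mul, ← ENNReal.rpow_mul]
        ring
    _ = _ := by
        rw [← ENNReal.rpow_add _ _ hA0 hA, ← ENNReal.rpow_add_of_nonneg _ _ hts hs0.le,
          ENNReal.mul_rpow_of_nonneg _ _ ht0.le, ENNReal.mul_rpow_of_nonneg _ _ ht0.le,
          ← ENNReal.rpow_mul, ← ENNReal.rpow_mul]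
        have e1 : (1 - s⁻¹) * (t - s) + s = (1 - (s⁻¹ - t⁻¹)) * t := by field_simp; ring
        have e2 : s⁻¹ * (t - s) = (s⁻¹ - t⁻¹) * t := by field_simp
        rw [e1, e2, sub_add_cancel]

end Young

section Multiplier

open scoped ContDiff

/-- A smooth compactly supported function agreeing with `‖ξ‖ ^ s`, up to normalization, on an annulus
away from the origin. -/
theorem exists_contDiff_eq_norm_rpow {V : Type*} [NormedAddCommGroup V]
    [InnerProductSpace ℝ V] [FiniteDimensional ℝ V] (s : ℝ) {K₁ K₂ : ℝ} (hK₁ : 0 < K₁) (hK₂ : K₁ ≤ K₂) :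
    ∃ m : V → ℂ, ContDiff ℝ ∞ m ∧ HasCompactSupport m ∧ ∀ ξ, K₁ ≤ ‖ξ‖ → ‖ξ‖ ≤ K₂ →
      m ξ = (((2 * Real.pi * ‖ξ‖) ^ s : ℝ) : ℂ) := by
  let χ : ContDiffBump ((K₁ + K₂) / 2) :=
    ⟨(K₂ - K₁) / 2 + K₁ / 4, (K₂ - K₁) / 2 + K₁ / 2, by linarith, by linarith⟩
  have hχ : ∀ t, t ≤ K₁ / 2 ∨ K₂ + K₁ / 2 ≤ t → χ t = 0 := fun t ht => by
    refine χ.zero_of_le_dist ?_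
    change (K₂ - K₁) / 2 + K₁ / 2 ≤ _
    rw [Real.dist_eq, le_abs]
    rcases ht with ht | ht
    · right; linarith
    · left; linarith
  refine ⟨fun ξ => ((χ ‖ξ‖ * (2 * Real.pi * ‖ξ‖) ^ s : ℝ) : ℂ), ?_, ?_, ?_⟩
  · refine Complex.ofRealCLM.contDiff.comp (contDiff_iff_contDiffAt.2 fun ξ => ?_)
    rcases eq_or_ne ξ 0 with rfl | hξ
    · refine (contDiffAt_const (c := (0 : ℝ))).congr_of_eventuallyEq ?_
      filter_upwards [Metric.ball_mem_nhds (0 : V) (half_pos hK₁)] with ξ hξ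
      rw [mem_ball_zero_iff] at hξ
      change χ ‖ξ‖ * _ = 0
      rw [hχ _ (.inl hξ.le), zero_mul]
    · have hn : ContDiffAt ℝ ∞ (fun ξ : V => ‖ξ‖) ξ := contDiffAt_norm ℝ hξ
      refine (χ.contDiff.contDiffAt.comp ξ hn).mul ?_
      refine (contDiffAt_const.mul hn).rpow_const_of_ne ?_
      have := norm_pos_iff.2 hξ
      positivity
  · refine HasCompactSupport.intro (isCompact_closedBall (0 : V) (K₂ + K₁ / 2)) fun ξ hξ => ?_
    rw [hχ _ (.inr (by simpa using (not_le.1 (by simpa using hξ)).le))]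
    simp
  · intro ξ h1 h2
    have : χ ‖ξ‖ = 1 := χ.one_of_mem_closedBall (by
      change dist _ _ ≤ (K₂ - K₁) / 2 + K₁ / 4
      rw [Real.dist_eq, abs_le]
      constructor <;> linarith)
    simp [this]

variable {V : Type*} [NormedAddCommGroup V] [InnerProductSpace ℝ V] [FiniteDimensional ℝ V]
  [MeasurableSpace V] [BorelSpace V]

open SchwartzMap

/-- The inverse Fourier transform of a dilated function. -/
theorem fourierInv_comp_inv_smul (m : V → ℂ) {c : ℝ} (hc : 0 < c) (x : V) :
    𝓕⁻ (fun ξ => m (c⁻¹ • ξ)) x = ((c ^ Module.finrank ℝ V : ℝ) : ℂ) * 𝓕⁻ m (c • x) := by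
  rw [Real.fourierInv_eq', Real.fourierInv_eq']
  have h := Measure.integral_comp_inv_smul_of_nonneg (μ := (volume : Measure V))
    (fun v : V => Complex.exp (↑(2 * Real.pi * inner ℝ v (c • x)) * Complex.I) • m v) hc.le
  rw [Complex.real_smul] at h
  rw [← h]
  congr 1 with ξ
  rw [inner_smul_left, inner_smul_right]
  simp [hc.ne']

theorem SchwartzMap.fourierInv_mul_fourier_apply (m f : 𝓢(V, ℂ)) (x : V) :
    𝓕⁻ (fun ξ => m ξ * 𝓕 (f : V → ℂ) ξ) x = ∫ y, 𝓕⁻ (m : V → ℂ) (x - y) * f y := by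
  have h := convolution_apply (ContinuousLinearMap.mul ℂ ℂ) (𝓕⁻ m) f x
  rw [MeasureTheory.convolution_eq_swap] at h
  simp only [ContinuousLinearMap.mul_apply', fourierInv_coe] at h
  rw [← h]
  change _ = (𝓕⁻ (pairing (ContinuousLinearMap.mul ℂ ℂ) (𝓕 (𝓕⁻ m)) (𝓕 f)) : 𝓢(V, ℂ)) x
  rw [fourierInv_coe, FourierTransform.fourier_fourierInv_eq]
  rfl

/-- A dilated smooth compactly supported Fourier multiplier maps `L^p` to `L^q`, and its norm scales
like `c ^ (d (1/p - 1/q))`. -/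
theorem exists_eLpNorm_fourierInv_mul_fourier_le {m : V → ℂ} (hm : ContDiff ℝ ∞ m)
    (hm' : HasCompactSupport m) {p q : ℝ≥0∞} (hp : 1 ≤ p) (hpq : p ≤ q) :
    ∃ C > (0 : ℝ), ∀ c : ℝ, 0 < c → ∀ f : 𝓢(V, ℂ),
      eLpNorm (𝓕⁻ (fun ξ => m (c⁻¹ • ξ) * 𝓕 (f : V → ℂ) ξ)) q volume
        ≤ ENNReal.ofReal (C * c ^ ((Module.finrank ℝ V : ℝ) * (p.toReal⁻¹ - q.toReal⁻¹)))
          * eLpNorm f p volume := by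
  set k : 𝓢(V, ℂ) := 𝓕⁻ (hm'.toSchwartzMap hm) with hk
  have hkm : ∀ x, k x = 𝓕⁻ m x := fun x => by rw [hk, fourierInv_coe]; rfl
  obtain ⟨B, hB0, hB⟩ : ∃ B > (0 : ℝ), ∀ x, ‖k x‖ ≤ B := by
    obtain ⟨B, hB⟩ := k.decay 0 0
    exact ⟨B, hB.1, fun x => by simpa using hB.2 x⟩
  set A : ℝ := (∫ x, ‖k x‖) + 1
  have hA0 : 0 < A := by positivity
  set θ := p.toReal⁻¹ - q.toReal⁻¹
  set n := Module.finrank ℝ V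
  refine ⟨A ^ (1 - θ) * B ^ θ, by positivity, fun c hc f => ?_⟩
  have hcn : 0 < c ^ n := by positivity
  set K : V → ℝ≥0∞ := fun x => ENNReal.ofReal (c ^ n) * ‖k (c • x)‖ₑ
  have hKmeas : Measurable K := by
    have : Continuous fun x => k (c • x) := k.continuous.comp (continuous_const_smul c)
    exact this.measurable.enorm.const_mul _
  have hsm : ContDiff ℝ ∞ fun ξ => m (c⁻¹ • ξ) := hm.comp (contDiff_const_smul _)
  have hcs : HasCompactSupport fun ξ => m (c⁻¹ • ξ) := hm'.comp_smul (inv_ne_zero hc.ne')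
  have hconv : ∀ x, ‖𝓕⁻ (fun ξ => m (c⁻¹ • ξ) * 𝓕 (f : V → ℂ) ξ) x‖ₑ
      ≤ ∫⁻ y, K (x - y) * ‖f y‖ₑ := by
    intro x
    have h := fourierInv_mul_fourier_apply (hcs.toSchwartzMap hsm) f x
    change 𝓕⁻ (fun ξ => m (c⁻¹ • ξ) * 𝓕 (f : V → ℂ) ξ) x
      = ∫ y, 𝓕⁻ (fun ξ => m (c⁻¹ • ξ)) (x - y) * f y at h
    rw [h]
    refine (enorm_integral_le_lintegral_enorm _).trans_eq (lintegral_congr fun y => ?_)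
    rw [fourierInv_comp_inv_smul m hc, ← hkm, enorm_mul, enorm_mul]
    congr 2
    rw [← ofReal_norm, Complex.norm_real, Real.norm_of_nonneg hcn.le]
  have hKA : ∫⁻ y, K y ≤ ENNReal.ofReal A := by
    have hi : Integrable fun y => c ^ n * ‖k (c • y)‖ :=
      ((k.integrable.comp_smul hc.ne').norm).const_mul _
    have : ∀ y, K y = ENNReal.ofReal (c ^ n * ‖k (c • y)‖) := fun y => by
      rw [ENNReal.ofReal_mul hcn.le, ofReal_norm]
    simp_rw [this]
    rw [← ofReal_integral_eq_lintegral_ofReal hi (.of_forall fun y => by positivity)]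
    refine ENNReal.ofReal_le_ofReal ?_
    rw [integral_const_mul, Measure.integral_comp_smul_of_nonneg volume (fun y => ‖k y‖) c
      (hR := hc.le), smul_eq_mul, mul_inv_cancel_left₀ hcn.ne']
    exact (lt_add_one _).le
  have hKB : ∀ x, K x ≤ ENNReal.ofReal (c ^ n * B) := fun x => by
    rw [ENNReal.ofReal_mul hcn.le]
    refine mul_le_mul_right ?_ _
    rw [← ofReal_norm]
    exact ENNReal.ofReal_le_ofReal (hB _)
  have hcB : 0 < c ^ n * B := by positivity
  refine (eLpNorm_le_of_enorm_le_lintegral_conv hKmeas f.continuous.measurable.enorm hconv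
    (ENNReal.ofReal_pos.2 hA0).ne' ENNReal.ofReal_ne_top
    hKA hKB hp hpq).trans_eq ?_
  rw [ENNReal.ofReal_rpow_of_pos hA0, ENNReal.ofReal_rpow_of_pos hcB,
    ← ENNReal.ofReal_mul (by positivity), Real.mul_rpow hcn.le hB0.le, ← Real.rpow_natCast,
    ← Real.rpow_mul hc.le]
  congr 2
  ring

end Multiplier

/-- Bernstein inequality, annulus case: if `𝓕u` is supported in the annulus
`{K₁ 2^j ≤ |ξ| ≤ K₂ 2^j}`, then
`C₁ 2^{2αj} ‖u‖_{L^q} ≤ ‖(-Δ)^α u‖_{L^q} ≤ C₂ 2^{2αj + jd(1/p - 1/q)} ‖u‖_{L^p}`,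
where `(-Δ)^α u = 𝓕⁻¹((2π|ξ|)^{2α} 𝓕u)`. -/
theorem bernstein_annulus
    (d : ℕ) (hd : 1 ≤ d) (α : ℝ) (hα : 0 ≤ α)
    (p q : ℝ≥0∞) (hp : 1 ≤ p) (hpq : p ≤ q)
    (K₁ K₂ : ℝ) (hK₁ : 0 < K₁) (hK₂ : K₁ ≤ K₂) :
    ∃ C₁ > (0 : ℝ), ∃ C₂ > (0 : ℝ), ∀ (j : ℤ) (u : SchwartzMap (EuclideanSpace ℝ (Fin d)) ℂ),
      (Function.support (𝓕 (⇑u)) ⊆ {ξ : EuclideanSpace ℝ (Fin d) |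
          K₁ * 2 ^ j ≤ ‖ξ‖ ∧ ‖ξ‖ ≤ K₂ * 2 ^ j}) →
      ENNReal.ofReal (C₁ * (2 : ℝ) ^ (2 * α * (j : ℝ))) * eLpNorm (⇑u) q volume
          ≤ eLpNorm
              (𝓕⁻ (fun ξ : EuclideanSpace ℝ (Fin d) =>
                (((2 * Real.pi * ‖ξ‖) ^ (2 * α) : ℝ) : ℂ) * 𝓕 (⇑u) ξ)) q volume
        ∧ eLpNorm
              (𝓕⁻ (fun ξ : EuclideanSpace ℝ (Fin d) =>
                (((2 * Real.pi * ‖ξ‖) ^ (2 * α) : ℝ) : ℂ) * 𝓕 (⇑u) ξ)) q volume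
            ≤ ENNReal.ofReal
                  (C₂ * (2 : ℝ) ^ (2 * α * (j : ℝ) + (j : ℝ) * (d : ℝ) * (p.toReal⁻¹ - q.toReal⁻¹)))
                * eLpNorm (⇑u) p volume := by
  obtain ⟨m, hm, hm', hm_eq⟩ := exists_contDiff_eq_norm_rpow (V := EuclideanSpace ℝ (Fin d))
    (2 * α) hK₁ hK₂
  obtain ⟨m', hn, hn', hm'_eq⟩ := exists_contDiff_eq_norm_rpow (V := EuclideanSpace ℝ (Fin d))
    (-(2 * α)) hK₁ hK₂
  obtain ⟨C, hC, hCle⟩ := exists_eLpNorm_fourierInv_mul_fourier_le hm hm' hp hpq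
  obtain ⟨C', hC', hC'le⟩ := exists_eLpNorm_fourierInv_mul_fourier_le hn hn' (hp.trans hpq) le_rfl
  refine ⟨C'⁻¹, by positivity, C, hC, fun j u hu => ?_⟩
  set c : ℝ := 2 ^ j with hc_def
  have hc : 0 < c := by positivity
  have hc_rpow : ∀ a : ℝ, (2 : ℝ) ^ (a * j) = c ^ a := fun a => by
    rw [hc_def, ← Real.rpow_intCast, ← Real.rpow_mul zero_le_two, mul_comm]
  have hann : ∀ ξ, 𝓕 (u : EuclideanSpace ℝ (Fin d) → ℂ) ξ ≠ 0 →
      0 < ‖ξ‖ ∧ K₁ ≤ ‖c⁻¹ • ξ‖ ∧ ‖c⁻¹ • ξ‖ ≤ K₂ := fun ξ hξ => by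
    obtain ⟨h1, h2⟩ := hu hξ
    rw [norm_smul, norm_inv, Real.norm_of_nonneg hc.le, inv_mul_eq_div, le_div_iff₀ hc,
      div_le_iff₀ hc]
    exact ⟨(by positivity : 0 < K₁ * c).trans_le h1, h1, h2⟩
  have hscale : ∀ (ξ : EuclideanSpace ℝ (Fin d)) (s : ℝ),
      (2 * Real.pi * ‖c⁻¹ • ξ‖) ^ s = c ^ (-s) * (2 * Real.pi * ‖ξ‖) ^ s := fun ξ s => by
    rw [norm_smul, norm_inv, Real.norm_of_nonneg hc.le, mul_left_comm,
      Real.mul_rpow (by positivity) (by positivity), Real.inv_rpow hc.le, Real.rpow_neg hc.le]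
  set M : EuclideanSpace ℝ (Fin d) → ℂ := fun ξ =>
    (((2 * Real.pi * ‖ξ‖) ^ (2 * α) : ℝ) : ℂ) * 𝓕 (⇑u) ξ with hM
  have hM_eq : M = ((c ^ (2 * α) : ℝ) : ℂ) • fun ξ => m (c⁻¹ • ξ) * 𝓕 (⇑u) ξ := by
    ext ξ
    rcases eq_or_ne (𝓕 (⇑u) ξ) 0 with h0 | h0
    · simp [hM, h0]
    · obtain ⟨-, h1, h2⟩ := hann ξ h0
      simp only [hM, Pi.smul_apply, smul_eq_mul]
      rw [hm_eq _ h1 h2, hscale, ← mul_assoc, ← Complex.ofReal_mul, ← mul_assoc,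
        ← Real.rpow_add hc, add_neg_cancel, Real.rpow_zero, one_mul]
  have hu_eq : (fun ξ => m' (c⁻¹ • ξ) * M ξ) = ((c ^ (2 * α) : ℝ) : ℂ) • 𝓕 (⇑u) := by
    ext ξ
    rcases eq_or_ne (𝓕 (⇑u) ξ) 0 with h0 | h0
    · simp [hM, h0]
    · obtain ⟨hξ, h1, h2⟩ := hann ξ h0
      simp only [hM, Pi.smul_apply, smul_eq_mul]
      rw [hm'_eq _ h1 h2, hscale, ← mul_assoc, ← Complex.ofReal_mul, mul_assoc (c ^ _),
        ← Real.rpow_add (by positivity), neg_add_cancel, Real.rpow_zero, mul_one, neg_neg]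
  have hnorm : ‖((c ^ (2 * α) : ℝ) : ℂ)‖ₑ = ENNReal.ofReal (c ^ (2 * α)) := by
    rw [← ofReal_norm, Complex.norm_real, Real.norm_of_nonneg (by positivity)]
  obtain ⟨W, hW, hFW⟩ : ∃ W : SchwartzMap (EuclideanSpace ℝ (Fin d)) ℂ, ⇑W = 𝓕⁻ M ∧
      𝓕 (⇑W) = M := by
    let mc : SchwartzMap (EuclideanSpace ℝ (Fin d)) ℂ :=
      HasCompactSupport.toSchwartzMap (f := fun ξ => m (c⁻¹ • ξ))
        (hm'.comp_smul (inv_ne_zero hc.ne')) (hm.comp (contDiff_const_smul _))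
    let Φ : SchwartzMap (EuclideanSpace ℝ (Fin d)) ℂ := ((c ^ (2 * α) : ℝ) : ℂ) •
      SchwartzMap.pairing (ContinuousLinearMap.mul ℂ ℂ) mc (𝓕 u)
    have hΦ : ⇑Φ = M := by rw [hM_eq]; rfl
    refine ⟨𝓕⁻ Φ, by rw [SchwartzMap.fourierInv_coe, hΦ], ?_⟩
    rw [← SchwartzMap.fourier_coe, FourierTransform.fourier_fourierInv_eq, hΦ]
  have hsmul : ∀ (a : ℂ) (g : EuclideanSpace ℝ (Fin d) → ℂ), 𝓕⁻ (a • g) = a • 𝓕⁻ g := by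
    intro a g
    ext x
    simp only [Real.fourierInv_eq', Pi.smul_apply, smul_eq_mul, mul_left_comm _ a]
    exact integral_const_mul _ _
  constructor
  · have h := hC'le c hc W
    rw [hFW, hu_eq, hsmul, eLpNorm_const_smul, hnorm, hW, sub_self, mul_zero, Real.rpow_zero,
      mul_one, ← SchwartzMap.fourier_coe, ← SchwartzMap.fourierInv_coe,
      FourierTransform.fourierInv_fourier_eq] at h
    rw [hc_rpow, ENNReal.ofReal_mul (by positivity), ENNReal.ofReal_inv_of_pos hC', mul_assoc,
      mul_comm, ← div_eq_mul_inv]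
    exact ENNReal.div_le_of_le_mul' h
  · have h := hCle c hc u
    rw [finrank_euclideanSpace_fin] at h
    rw [hM_eq, hsmul, eLpNorm_const_smul, hnorm]
    refine (mul_le_mul_right h _).trans_eq ?_
    rw [← mul_assoc, ← ENNReal.ofReal_mul (by positivity),
      show 2 * α * (j : ℝ) + (j : ℝ) * (d : ℝ) * (p.toReal⁻¹ - q.toReal⁻¹)
        = (2 * α + d * (p.toReal⁻¹ - q.toReal⁻¹)) * j by ring, hc_rpow, Real.rpow_add hc]
    congr 2
    ring
end

section
/- Córdoba–Córdoba-type positivity inequality: let s ∈ [0,1] and p ∈ [2,∞), and let f : ℝ² → ℝ be a Schwartz function. Then ∫_{ℝ²} |f(x)|^{p−2} f(x) · ((−Δ)^s f)(x) dx ≥ (2/p) ∫_{ℝ²} (2π|ξ|)^{2s} |𝓕(|f|^{p/2})(ξ)|² dξ. -/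
open MeasureTheory
open scoped ENNReal FourierTransform

section Subordination

open Set Filter Topology

lemma integrableOn_rpow_mul_one_sub_exp {s : ℝ} (h0 : 0 < s) (h1 : s < 1) :
    IntegrableOn (fun t : ℝ => t ^ (-1 - s) * (1 - Real.exp (-t))) (Ioi 0) := by
  have hm : Measurable (fun t : ℝ => t ^ (-1 - s) * (1 - Real.exp (-t))) := by fun_prop
  rw [← Ioc_union_Ioi_eq_Ioi (zero_le_one (α := ℝ))]
  refine IntegrableOn.union ?_ ?_
  · have hi : IntegrableOn (fun t : ℝ => t ^ (-s)) (Ioc 0 1) := by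
      rw [← intervalIntegrable_iff_integrableOn_Ioc_of_le zero_le_one]
      exact intervalIntegral.intervalIntegrable_rpow' (by linarith)
    refine Integrable.mono' hi hm.aestronglyMeasurable ?_
    filter_upwards [ae_restrict_mem measurableSet_Ioc] with t ht
    have hexp := Real.add_one_le_exp (-t)
    have hexp1 : Real.exp (-t) ≤ 1 := Real.exp_le_one_iff.2 (by linarith [ht.1])
    have hpow : 0 ≤ t ^ (-1 - s) := Real.rpow_nonneg ht.1.le _
    rw [Real.norm_of_nonneg (mul_nonneg hpow (by linarith))]
    calc t ^ (-1 - s) * (1 - Real.exp (-t)) ≤ t ^ (-1 - s) * t := by gcongr; linarith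
      _ = t ^ (-s) := by rw [← Real.rpow_add_one ht.1.ne']; ring_nf
  · have hi : IntegrableOn (fun t : ℝ => t ^ (-1 - s)) (Ioi 1) :=
      integrableOn_Ioi_rpow_of_lt (by linarith) one_pos
    refine Integrable.mono' hi hm.aestronglyMeasurable ?_
    filter_upwards [ae_restrict_mem measurableSet_Ioi] with t ht
    have ht0 : 0 < t := one_pos.trans ht
    have hexp1 : Real.exp (-t) ≤ 1 := Real.exp_le_one_iff.2 (by linarith)
    have hpow : 0 ≤ t ^ (-1 - s) := Real.rpow_nonneg ht0.le _
    rw [Real.norm_of_nonneg (mul_nonneg hpow (by linarith))]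
    exact mul_le_of_le_one_right hpow (by linarith [Real.exp_pos (-t)])

lemma integral_rpow_mul_one_sub_exp_pos {s : ℝ} (h0 : 0 < s) (h1 : s < 1) :
    0 < ∫ t in Ioi (0 : ℝ), t ^ (-1 - s) * (1 - Real.exp (-t)) := by
  have hpos : ∀ t ∈ Ioi (0 : ℝ), 0 < t ^ (-1 - s) * (1 - Real.exp (-t)) := fun t ht =>
    mul_pos (Real.rpow_pos_of_pos ht _)
      (sub_pos.2 (Real.exp_lt_one_iff.2 (neg_lt_zero.2 ht)))
  rw [setIntegral_pos_iff_support_of_nonneg_ae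
    ((ae_restrict_mem measurableSet_Ioi).mono fun t ht => (hpos t ht).le)
    (integrableOn_rpow_mul_one_sub_exp h0 h1)]
  have hsub : Ioi (0 : ℝ) ⊆ Function.support fun t : ℝ => t ^ (-1 - s) * (1 - Real.exp (-t)) :=
    fun t ht => (hpos t ht).ne'
  rw [inter_eq_right.2 hsub]
  simp

lemma rpow_mul_one_sub_exp_scale {s t L : ℝ} (hL : 0 < L) (ht : 0 < t) :
    t ^ (-1 - s) * (1 - Real.exp (-(t * L)))
      = L ^ (1 + s) * ((L * t) ^ (-1 - s) * (1 - Real.exp (-(L * t)))) := by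
  rw [Real.mul_rpow hL.le ht.le, mul_comm t L, ← mul_assoc, ← mul_assoc,
    ← Real.rpow_add hL]
  simp

lemma integrableOn_rpow_mul_one_sub_exp_mul {s L : ℝ} (h0 : 0 < s) (h1 : s < 1) (hL : 0 ≤ L) :
    IntegrableOn (fun t : ℝ => t ^ (-1 - s) * (1 - Real.exp (-(t * L)))) (Ioi 0) := by
  rcases hL.eq_or_lt with rfl | hL
  · simp
  refine IntegrableOn.congr_fun ?_
    (fun t ht => (rpow_mul_one_sub_exp_scale (s := s) hL ht).symm) measurableSet_Ioi
  refine Integrable.const_mul ?_ _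
  have := (integrableOn_Ioi_comp_mul_left_iff
    (fun t : ℝ => t ^ (-1 - s) * (1 - Real.exp (-t))) 0 hL).2
  rw [mul_zero] at this
  exact this (integrableOn_rpow_mul_one_sub_exp h0 h1)

lemma integral_rpow_mul_one_sub_exp_mul {s L : ℝ} (h0 : 0 < s) (hL : 0 ≤ L) :
    ∫ t in Ioi (0 : ℝ), t ^ (-1 - s) * (1 - Real.exp (-(t * L)))
      = (∫ t in Ioi (0 : ℝ), t ^ (-1 - s) * (1 - Real.exp (-t))) * L ^ s := by
  rcases hL.eq_or_lt with rfl | hL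
  · simp [h0.ne']
  rw [setIntegral_congr_fun measurableSet_Ioi
    (fun t ht => rpow_mul_one_sub_exp_scale (s := s) hL ht), integral_const_mul,
    integral_comp_mul_left_Ioi (fun t : ℝ => t ^ (-1 - s) * (1 - Real.exp (-t))) 0 hL,
    mul_zero, smul_eq_mul, ← mul_assoc, mul_comm (_ * _)]
  congr 1
  rw [Real.rpow_add hL, Real.rpow_one]
  field_simp

variable {X : Type*} [MeasurableSpace X] {μ : Measure X}

lemma integral_le_integral_of_tendsto_weights {W G₁ G₂ : X → ℝ} {w : ℕ → X → ℝ}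
    (hw : ∀ n, Measurable (w n)) (hw0 : ∀ n x, 0 ≤ w n x) (hwW : ∀ n x, w n x ≤ W x)
    (hlim : ∀ᵐ x ∂μ, Tendsto (fun n => w n x) atTop (𝓝 (W x)))
    (hG₁ : AEStronglyMeasurable G₁ μ) (hG₁0 : ∀ x, 0 ≤ G₁ x) (hG₂ : AEStronglyMeasurable G₂ μ)
    (hWG₂ : Integrable (fun x => W x * G₂ x) μ)
    (H : ∀ n, ∫ x, w n x * G₁ x ∂μ ≤ ∫ x, w n x * G₂ x ∂μ) :
    ∫ x, W x * G₁ x ∂μ ≤ ∫ x, W x * G₂ x ∂μ := by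
  have key : ∀ G : X → ℝ, AEStronglyMeasurable G μ → Integrable (fun x => W x * G x) μ →
      Tendsto (fun n => ∫ x, w n x * G x ∂μ) atTop (𝓝 (∫ x, W x * G x ∂μ)) := by
    intro G hG hWG
    refine tendsto_integral_of_dominated_convergence (fun x => ‖W x * G x‖)
      (fun n => (hw n).aestronglyMeasurable.mul hG) hWG.norm (fun n => .of_forall fun x => ?_)
      (hlim.mono fun x hx => hx.mul_const _)
    rw [norm_mul, norm_mul]
    gcongr
    exact (Real.norm_of_nonneg (hw0 n x)).trans_le ((hwW n x).trans (Real.le_norm_self _))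
  by_cases h : Integrable (fun x => W x * G₁ x) μ
  · exact le_of_tendsto_of_tendsto' (key G₁ hG₁ h) (key G₂ hG₂ hWG₂) H
  · rw [integral_undef h]
    exact ge_of_tendsto' (key G₂ hG₂ hWG₂) fun n =>
      (integral_nonneg fun x => mul_nonneg (hw0 n x) (hG₁0 x)).trans (H n)

lemma integrable_prod_one_sub_exp_mul {s : ℝ} (h0 : 0 < s) (h1 : s < 1) {l G : X → ℝ}
    (hl : Measurable l) (hl0 : ∀ x, 0 ≤ l x) (hG : AEStronglyMeasurable G μ)
    (hlG : Integrable (fun x => l x ^ s * G x) μ) :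
    Integrable (fun z : X × ℝ => z.2 ^ (-1 - s) * (1 - Real.exp (-(z.2 * l z.1))) * G z.1)
      (μ.prod (volume.restrict (Ioi 0))) := by
  have hm : Measurable
      (fun z : X × ℝ => z.2 ^ (-1 - s) * (1 - Real.exp (-(z.2 * l z.1)))) := by fun_prop
  have hm' : AEStronglyMeasurable
      (fun z : X × ℝ => z.2 ^ (-1 - s) * (1 - Real.exp (-(z.2 * l z.1))) * G z.1)
      (μ.prod (volume.restrict (Ioi 0))) := hm.aestronglyMeasurable.mul hG.comp_fst
  rw [integrable_prod_iff hm']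
  constructor
  · exact .of_forall fun x =>
      (integrableOn_rpow_mul_one_sub_exp_mul h0 h1 (hl0 x)).mul_const (G x)
  · refine (hlG.norm.const_mul
      (∫ t in Ioi (0 : ℝ), t ^ (-1 - s) * (1 - Real.exp (-t)))).congr (.of_forall fun x => ?_)
    simp only [norm_mul _ (G x)]
    rw [integral_mul_const, Real.norm_of_nonneg (Real.rpow_nonneg (hl0 x) s), ← mul_assoc,
      ← integral_rpow_mul_one_sub_exp_mul h0 (hl0 x)]
    congr 1
    refine setIntegral_congr_fun measurableSet_Ioi fun t (ht : 0 < t) => ?_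
    refine (Real.norm_of_nonneg (mul_nonneg (Real.rpow_nonneg ht.le _) ?_)).symm
    exact sub_nonneg.2 (Real.exp_le_one_iff.2 (neg_nonpos.2 (mul_nonneg ht.le (hl0 x))))

variable [SFinite μ]

/-- Subordination of a fractional power to the exponentials `exp (-t l)`. -/
lemma integral_rpow_mul_eq_integral_one_sub_exp {s : ℝ} (h0 : 0 < s) (h1 : s < 1) {l G : X → ℝ}
    (hl : Measurable l) (hl0 : ∀ x, 0 ≤ l x) (hG : AEStronglyMeasurable G μ)
    (hlG : Integrable (fun x => l x ^ s * G x) μ) :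
    (∫ t in Ioi (0 : ℝ), t ^ (-1 - s) * (1 - Real.exp (-t))) * ∫ x, l x ^ s * G x ∂μ
      = ∫ t in Ioi (0 : ℝ), t ^ (-1 - s) * ∫ x, (1 - Real.exp (-(t * l x))) * G x ∂μ := by
  have := integral_integral_swap
    (f := fun x t => t ^ (-1 - s) * (1 - Real.exp (-(t * l x))) * G x)
    (integrable_prod_one_sub_exp_mul h0 h1 hl hl0 hG hlG)
  simp only [mul_assoc, integral_const_mul] at this
  rw [← this, ← integral_const_mul]
  refine integral_congr_ae (.of_forall fun x => ?_)
  simp only [← mul_assoc]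
  rw [integral_mul_const, integral_rpow_mul_one_sub_exp_mul h0 (hl0 x)]

lemma integrableOn_rpow_mul_integral_one_sub_exp {s : ℝ} (h0 : 0 < s) (h1 : s < 1)
    {l G : X → ℝ} (hl : Measurable l) (hl0 : ∀ x, 0 ≤ l x) (hG : AEStronglyMeasurable G μ)
    (hlG : Integrable (fun x => l x ^ s * G x) μ) :
    IntegrableOn (fun t => t ^ (-1 - s) * ∫ x, (1 - Real.exp (-(t * l x))) * G x ∂μ) (Ioi 0) := by
  refine (integrable_prod_one_sub_exp_mul h0 h1 hl hl0 hG hlG).integral_prod_right.congr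
    (.of_forall fun t => ?_)
  simp only [mul_assoc, integral_const_mul]

/-- An inequality between the weights `1 - exp (-t l)` for all `t > 0` is inherited by the
weights `l ^ s`, `0 ≤ s ≤ 1`. -/
lemma integral_rpow_mul_le_of_one_sub_exp {s : ℝ} (hs : s ∈ Icc (0 : ℝ) 1) {l G₁ G₂ : X → ℝ}
    (hl : Measurable l) (hl0 : ∀ x, 0 ≤ l x) (hlpos : ∀ᵐ x ∂μ, 0 < l x)
    (hG₁ : AEStronglyMeasurable G₁ μ) (hG₁0 : ∀ x, 0 ≤ G₁ x) (hG₂ : AEStronglyMeasurable G₂ μ)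
    (hlG₂ : Integrable (fun x => l x ^ s * G₂ x) μ)
    (H : ∀ t : ℝ, 0 < t → ∫ x, (1 - Real.exp (-(t * l x))) * G₁ x ∂μ
      ≤ ∫ x, (1 - Real.exp (-(t * l x))) * G₂ x ∂μ) :
    ∫ x, l x ^ s * G₁ x ∂μ ≤ ∫ x, l x ^ s * G₂ x ∂μ := by
  have hw0 : ∀ t : ℝ, 0 < t → ∀ x, 0 ≤ 1 - Real.exp (-(t * l x)) := fun t ht x =>
    sub_nonneg.2 (Real.exp_le_one_iff.2 (neg_nonpos.2 (mul_nonneg ht.le (hl0 x))))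
  have hpos : ∀ n : ℕ, (0 : ℝ) < n + 1 := fun n => by positivity
  have hn : Tendsto (fun n : ℕ => (n : ℝ) + 1) atTop atTop :=
    tendsto_atTop_add_const_right _ _ tendsto_natCast_atTop_atTop
  rcases hs.1.eq_or_lt with rfl | h0
  · refine integral_le_integral_of_tendsto_weights
      (w := fun n x => 1 - Real.exp (-((n + 1 : ℝ) * l x))) (fun n => by fun_prop)
      (fun n => hw0 _ (hpos n)) (fun n x => ?_) ?_ hG₁ hG₁0 hG₂ hlG₂ (fun n => H _ (hpos n))
    · simp [(Real.exp_pos _).le]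
    · filter_upwards [hlpos] with x hx
      have := Real.tendsto_exp_neg_atTop_nhds_zero.comp (hn.atTop_mul_const hx)
      simpa using this.const_sub 1
  rcases hs.2.eq_or_lt with rfl | h1
  · refine integral_le_integral_of_tendsto_weights
      (w := fun n x => (n + 1 : ℝ) * (1 - Real.exp (-((n + 1 : ℝ)⁻¹ * l x))))
      (fun n => by fun_prop)
      (fun n x => mul_nonneg (hpos n).le (hw0 _ (inv_pos.2 (hpos n)) x)) (fun n x => ?_) ?_
      hG₁ hG₁0 hG₂ hlG₂ (fun n => ?_)
    · have h := Real.add_one_le_exp (-((n + 1 : ℝ)⁻¹ * l x))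
      have h' : (n + 1 : ℝ) * (1 - Real.exp (-((n + 1 : ℝ)⁻¹ * l x)))
          ≤ (n + 1) * ((n + 1 : ℝ)⁻¹ * l x) := by gcongr; linarith
      rw [mul_inv_cancel_left₀ (hpos n).ne'] at h'
      exact h'.trans_eq (Real.rpow_one _).symm
    · refine .of_forall fun x => ?_
      have hd : HasDerivAt (fun t : ℝ => 1 - Real.exp (-(t * l x))) (l x) 0 := by
        have h := ((((hasDerivAt_id (0 : ℝ)).mul_const (l x)).neg).exp).const_sub 1
        simpa using h
      have ht : Tendsto (fun n : ℕ => ((n : ℝ) + 1)⁻¹) atTop (𝓝[≠] 0) :=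
        tendsto_nhdsWithin_iff.2 ⟨tendsto_inv_atTop_zero.comp hn,
          .of_forall fun n => (inv_pos.2 (hpos n)).ne'⟩
      have h := hd.tendsto_slope.comp ht
      simpa [Function.comp_def, slope_def_field, div_eq_mul_inv, mul_comm] using h
    · simp only [mul_assoc, integral_const_mul]
      exact mul_le_mul_of_nonneg_left (by simpa only [mul_assoc] using H _ (inv_pos.2 (hpos n)))
        (hpos n).le
  · have hC := integral_rpow_mul_one_sub_exp_pos h0 h1
    refine le_of_mul_le_mul_left ?_ hC
    rw [integral_rpow_mul_eq_integral_one_sub_exp h0 h1 hl hl0 hG₂ hlG₂]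
    by_cases h : Integrable (fun x => l x ^ s * G₁ x) μ
    · rw [integral_rpow_mul_eq_integral_one_sub_exp h0 h1 hl hl0 hG₁ h]
      refine setIntegral_mono_on
        (integrableOn_rpow_mul_integral_one_sub_exp h0 h1 hl hl0 hG₁ h)
        (integrableOn_rpow_mul_integral_one_sub_exp h0 h1 hl hl0 hG₂ hlG₂) measurableSet_Ioi
        fun t ht => mul_le_mul_of_nonneg_left (H t ht) (Real.rpow_nonneg (le_of_lt ht) _)
    · rw [integral_undef h, mul_zero]
      refine setIntegral_nonneg measurableSet_Ioi fun t ht =>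
        mul_nonneg (Real.rpow_nonneg (le_of_lt ht) _) ?_
      exact (integral_nonneg fun x => mul_nonneg (hw0 t ht x) (hG₁0 x)).trans (H t ht)

end Subordination

section Energy

variable {V : Type*} [NormedAddCommGroup V] [InnerProductSpace ℝ V] [FiniteDimensional ℝ V]
  [MeasurableSpace V] [BorelSpace V]

lemma exists_heat_kernel {t : ℝ} (ht : 0 < t) : ∃ (k : V → ℝ) (C : ℝ), Continuous k ∧
    (∀ z, 0 ≤ k z) ∧ (∀ z, k z ≤ C) ∧ Integrable k ∧ ∫ z, k z = 1 ∧
    ∀ z, 𝓕 (fun ξ : V => ((Real.exp (-(t * (2 * Real.pi * ‖ξ‖) ^ 2)) : ℝ) : ℂ)) z = k z := by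
  have hpi := Real.pi_pos
  obtain ⟨b, hb, hbt⟩ : ∃ b : ℝ, 0 < b ∧ b = t * (2 * Real.pi) ^ 2 := ⟨_, by positivity, rfl⟩
  have hint : ∫ z : V, Real.exp (-(Real.pi ^ 2 / b) * ‖z‖ ^ 2)
      = (Real.pi / (Real.pi ^ 2 / b)) ^ (Module.finrank ℝ V / 2 : ℝ) :=
    GaussianFourier.integral_rexp_neg_mul_sq_norm (by positivity)
  have hone : (Real.pi / b) ^ (Module.finrank ℝ V / 2 : ℝ) *
      (Real.pi / (Real.pi ^ 2 / b)) ^ (Module.finrank ℝ V / 2 : ℝ) = 1 := by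
    rw [← Real.mul_rpow (by positivity) (by positivity)]
    convert Real.one_rpow _
    field_simp
  refine ⟨fun z => (Real.pi / b) ^ (Module.finrank ℝ V / 2 : ℝ) *
    Real.exp (-(Real.pi ^ 2 / b) * ‖z‖ ^ 2), (Real.pi / b) ^ (Module.finrank ℝ V / 2 : ℝ),
    by fun_prop, fun z => by positivity, fun z => ?_, ?_, ?_, fun z => ?_⟩
  · refine mul_le_of_le_one_right (by positivity) (Real.exp_le_one_iff.2 ?_)
    rw [neg_mul, neg_nonpos]
    positivity
  · refine (Integrable.of_integral_ne_zero ?_).const_mul _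
    rw [hint]
    positivity
  · rw [integral_const_mul, hint, hone]
  · have h := fourier_gaussian_innerProductSpace (V := V) (b := (b : ℂ)) (by simpa using hb) z
    convert h using 2
    · ext ξ
      push_cast [hbt]
      congr 1
      ring
    · push_cast
      rw [Complex.ofReal_cpow (by positivity)]
      push_cast
      congr 2
      ring

variable {u v m k : V → ℝ}

lemma integrable_kernel_mul_fst (hk : Integrable k) (hu : Integrable u) :
    Integrable (fun z : V × V => k (z.1 - z.2) * u z.1) := by
  have h := (hu.convolution_integrand (ContinuousLinearMap.mul ℝ ℝ) hk.comp_neg).swap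
  refine h.congr (.of_forall fun z => ?_)
  simp [mul_comm]

lemma integrable_kernel_mul_snd (hk : Integrable k) (hu : Integrable u) :
    Integrable (fun z : V × V => k (z.1 - z.2) * u z.2) := by
  refine (hu.convolution_integrand (ContinuousLinearMap.mul ℝ ℝ) hk).congr
    (.of_forall fun z => ?_)
  simp [mul_comm]

lemma integral_kernel_mul_fst (hk : Integrable k) (hk1 : ∫ z, k z = 1) (hu : Integrable u) :
    ∫ z : V × V, k (z.1 - z.2) * u z.1 = ∫ x, u x := by
  rw [Measure.volume_eq_prod, integral_prod _ (integrable_kernel_mul_fst hk hu)]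
  simp only [integral_mul_const, integral_sub_left_eq_self, hk1, one_mul]

lemma integral_kernel_mul_snd (hk : Integrable k) (hk1 : ∫ z, k z = 1) (hu : Integrable u) :
    ∫ z : V × V, k (z.1 - z.2) * u z.2 = ∫ x, u x := by
  rw [Measure.volume_eq_prod, integral_prod_symm _ (integrable_kernel_mul_snd hk hu)]
  simp only [integral_mul_const, integral_sub_right_eq_self, hk1, one_mul]

lemma integrable_kernel_mul_mul {C : ℝ} (hkc : Continuous k) (hk0 : ∀ z, 0 ≤ k z)
    (hkC : ∀ z, k z ≤ C) (hu : Integrable u) (hv : Integrable v) :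
    Integrable (fun z : V × V => k (z.1 - z.2) * (u z.1 * v z.2)) := by
  refine (hu.mul_prod hv).bdd_mul (c := C) (by fun_prop) (.of_forall fun z => ?_)
  rw [Real.norm_of_nonneg (hk0 _)]
  exact hkC _

lemma star_fourier_ofReal (v : V → ℝ) (ξ : V) :
    (starRingEnd ℂ) (𝓕 (fun y => (v y : ℂ)) ξ) = 𝓕⁻ (fun y => (v y : ℂ)) ξ := by
  rw [Real.fourier_eq', Real.fourierInv_eq', ← integral_conj]
  refine integral_congr_ae (.of_forall fun x => ?_)
  simp [← Complex.exp_conj, Complex.conj_ofNat]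

/-- Parseval's identity for a convolution quadratic form. -/
lemma integral_mul_fourier_mul_star_fourier (hm : Integrable m)
    (hmk : ∀ z, 𝓕 (fun ξ => (m ξ : ℂ)) z = k z) (hu : Integrable u) (hv : Integrable v) :
    ∫ ξ, m ξ * (𝓕 (fun y => (u y : ℂ)) ξ * (starRingEnd ℂ) (𝓕 (fun y => (v y : ℂ)) ξ)).re
      = ∫ z : V × V, k (z.1 - z.2) * (u z.1 * v z.2) := by
  obtain ⟨h, hcomplex⟩ : Integrable (fun ξ => (m ξ : ℂ) *
      (𝓕 (fun y => (u y : ℂ)) ξ * (starRingEnd ℂ) (𝓕 (fun y => (v y : ℂ)) ξ))) ∧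
      ∫ ξ, (m ξ : ℂ) *
      (𝓕 (fun y => (u y : ℂ)) ξ * (starRingEnd ℂ) (𝓕 (fun y => (v y : ℂ)) ξ))
      = ∫ z : V × V, ((k (z.1 - z.2) * (u z.1 * v z.2) : ℝ) : ℂ) := by
    let e : V → V × V → ℂ := fun ξ z =>
      Complex.exp ((-2 * Real.pi * inner ℝ (z.1 - z.2) ξ : ℝ) * Complex.I)
    have hint : Integrable (Function.uncurry fun (ξ : V) (z : V × V) =>
        e ξ z * ((m ξ : ℂ) * ((u z.1 : ℂ) * (v z.2 : ℂ)))) (volume.prod volume) := by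
      refine (hm.ofReal.mul_prod (hu.ofReal.mul_prod hv.ofReal)).bdd_mul (c := 1) ?_ ?_
      · refine Continuous.aestronglyMeasurable ?_
        simp only [e]
        fun_prop
      · exact .of_forall fun z => (Complex.norm_exp_ofReal_mul_I _).le
    have hswap := integral_integral_swap hint
    have hl : ∀ ξ, ∫ z, e ξ z * ((m ξ : ℂ) * ((u z.1 : ℂ) * (v z.2 : ℂ))) = (m ξ : ℂ) *
        (𝓕 (fun y => (u y : ℂ)) ξ * (starRingEnd ℂ) (𝓕 (fun y => (v y : ℂ)) ξ)) := by
      intro ξ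
      rw [star_fourier_ofReal, Real.fourier_eq', Real.fourierInv_eq', ← integral_prod_mul,
        ← integral_const_mul]
      refine integral_congr_ae (.of_forall fun z => ?_)
      have : e ξ z = Complex.exp ((-2 * Real.pi * inner ℝ z.1 ξ : ℝ) * Complex.I) *
          Complex.exp ((2 * Real.pi * inner ℝ z.2 ξ : ℝ) * Complex.I) := by
        rw [← Complex.exp_add]
        simp only [e, inner_sub_left]
        congr 1
        push_cast
        ring
      simp only [this, smul_eq_mul]
      ring
    have hr : ∀ z : V × V, ∫ ξ, e ξ z * ((m ξ : ℂ) * ((u z.1 : ℂ) * (v z.2 : ℂ)))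
        = ((k (z.1 - z.2) * (u z.1 * v z.2) : ℝ) : ℂ) := by
      intro z
      push_cast
      rw [← hmk, Real.fourier_eq', ← integral_mul_const]
      refine integral_congr_ae (.of_forall fun ξ => ?_)
      simp only [e, smul_eq_mul, real_inner_comm, mul_assoc]
    refine ⟨?_, by simpa only [hl, hr] using hswap⟩
    simpa only [Function.uncurry, hl] using hint.integral_prod_left
  rw [integral_complex_ofReal] at hcomplex
  rw [← Complex.ofReal_re (∫ z : V × V, _), ← hcomplex]
  rw [← Complex.reCLM_apply, ← Complex.reCLM.integral_comp_comm h]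
  simp

lemma continuous_fourier_of_integrable {F : V → ℂ} (hF : Integrable F) : Continuous (𝓕 F) :=
  VectorFourier.fourierIntegral_continuous Real.continuous_fourierChar
    (by simpa using continuous_inner) hF

lemma norm_fourier_le_integral_norm (F : V → ℂ) (ξ : V) : ‖𝓕 F ξ‖ ≤ ∫ x, ‖F x‖ :=
  VectorFourier.norm_fourierIntegral_le_integral_norm _ _ _ _ _

lemma continuous_fourierInv_of_integrable {F : V → ℂ} (hF : Integrable F) :
    Continuous (𝓕⁻ F) := by
  rw [Real.fourierInv_eq_fourier_comp_neg]
  exact continuous_fourier_of_integrable hF.comp_neg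

lemma norm_fourierInv_le_integral_norm (F : V → ℂ) (x : V) : ‖𝓕⁻ F x‖ ≤ ∫ ξ, ‖F ξ‖ := by
  rw [Real.fourierInv_eq_fourier_neg]
  exact norm_fourier_le_integral_norm F (-x)

lemma integrable_mul_star_fourier {F : V → ℂ} (hF : Integrable F) (hv : Integrable v) :
    Integrable fun ξ => F ξ * (starRingEnd ℂ) (𝓕 (fun y => (v y : ℂ)) ξ) := by
  simp only [star_fourier_ofReal]
  exact hF.mul_bdd (c := ∫ y, ‖(v y : ℂ)‖)
    (continuous_fourierInv_of_integrable hv.ofReal).aestronglyMeasurable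
    (.of_forall (norm_fourierInv_le_integral_norm _))

lemma integral_mul_re_fourierInv {F : V → ℂ} (hF : Integrable F) (hv : Integrable v) :
    ∫ x, v x * (𝓕⁻ F x).re
      = ∫ ξ, (F ξ * (starRingEnd ℂ) (𝓕 (fun y => (v y : ℂ)) ξ)).re := by
  have hL : Continuous fun p : V × V => (-innerₗ V) p.1 p.2 := 
    (continuous_inner (𝕜 := ℝ) (E := V)).neg
  have hflip : (-innerₗ V).flip = -innerₗ V := by
    ext x y
    simp [real_inner_comm]
  have h : ∫ x, 𝓕⁻ F x * (v x : ℂ) = ∫ ξ, F ξ * 𝓕⁻ (fun y => (v y : ℂ)) ξ := by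
    have h := VectorFourier.integral_fourierIntegral_smul_eq_flip (f := F)
      (g := fun y => (v y : ℂ)) (L := -innerₗ V) (μ := volume) (ν := volume) Real.continuous_fourierChar hL hF hv.ofReal
    rw [hflip] at h
    exact h
  have hi : Integrable fun x => 𝓕⁻ F x * (v x : ℂ) :=
    hv.ofReal.bdd_mul (continuous_fourierInv_of_integrable hF).aestronglyMeasurable
      (.of_forall (norm_fourierInv_le_integral_norm _))
  simp only [← star_fourier_ofReal] at h
  have hre := congrArg Complex.reCLM h
  rw [← Complex.reCLM.integral_comp_comm hi,
    ← Complex.reCLM.integral_comp_comm (integrable_mul_star_fourier hF hv)] at hre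
  simpa [mul_comm] using hre

lemma integrable_exp_neg_norm_sq {t : ℝ} (ht : 0 < t) :
    Integrable fun ξ : V => Real.exp (-(t * (2 * Real.pi * ‖ξ‖) ^ 2)) := by
  have hpi := Real.pi_pos
  refine Integrable.of_integral_ne_zero ?_
  have h := GaussianFourier.integral_rexp_neg_mul_sq_norm (V := V)
    (b := t * (2 * Real.pi) ^ 2) (by positivity)
  simp only [neg_mul, mul_assoc, ← mul_pow] at h
  simp only [mul_assoc]
  rw [h]
  positivity

lemma exp_neg_mul_sq_le_one {t : ℝ} (ht : 0 ≤ t) (x : ℝ) : Real.exp (-(t * x ^ 2)) ≤ 1 :=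
  Real.exp_le_one_iff.2 (neg_nonpos.2 (by positivity))

lemma integral_exp_mul_norm_fourier_sq_le (hu : Integrable u)
    (hu2 : Integrable fun x => u x ^ 2) {t : ℝ} (ht : 0 < t) :
    ∫ ξ, Real.exp (-(t * (2 * Real.pi * ‖ξ‖) ^ 2)) * ‖𝓕 (fun y => (u y : ℂ)) ξ‖ ^ 2
      ≤ ∫ x, u x ^ 2 := by
  obtain ⟨k, C, hkc, hk0, hkC, hk, hk1, hmk⟩ := exists_heat_kernel (V := V) ht
  have h := integral_mul_fourier_mul_star_fourier (integrable_exp_neg_norm_sq ht) hmk hu hu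
  simp only [Complex.mul_conj, Complex.ofReal_re, Complex.normSq_eq_norm_sq] at h
  rw [h]
  have h1 := integrable_kernel_mul_fst hk hu2
  have h2 := integrable_kernel_mul_snd hk hu2
  calc ∫ z : V × V, k (z.1 - z.2) * (u z.1 * u z.2)
      ≤ ∫ z : V × V, (2⁻¹ * (k (z.1 - z.2) * u z.1 ^ 2) + 2⁻¹ * (k (z.1 - z.2) * u z.2 ^ 2)) := by
        refine integral_mono (integrable_kernel_mul_mul hkc hk0 hkC hu hu)
          ((h1.const_mul _).add (h2.const_mul _)) fun z => ?_
        nlinarith [mul_nonneg (hk0 (z.1 - z.2)) (sq_nonneg (u z.1 - u z.2))]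
    _ = ∫ x, u x ^ 2 := by
        rw [integral_add (h1.const_mul _) (h2.const_mul _), integral_const_mul,
          integral_const_mul, integral_kernel_mul_fst hk hk1 hu2,
          integral_kernel_mul_snd hk hk1 hu2]
        ring

open Filter Topology in
/-- One half of Plancherel's theorem on `L¹ ∩ L²`. -/
lemma integrable_norm_fourier_sq (hu : Integrable u) (hu2 : Integrable fun x => u x ^ 2) :
    Integrable (fun ξ => ‖𝓕 (fun y => (u y : ℂ)) ξ‖ ^ 2) ∧
      ∫ ξ, ‖𝓕 (fun y => (u y : ℂ)) ξ‖ ^ 2 ≤ ∫ x, u x ^ 2 := by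
  let U : V → ℝ := fun ξ => ‖𝓕 (fun y => (u y : ℂ)) ξ‖ ^ 2
  have hc : Continuous U := (continuous_fourier_of_integrable hu.ofReal).norm.pow 2
  have hU0 : ∀ ξ, 0 ≤ U ξ := fun ξ => sq_nonneg _
  let t : ℕ → ℝ := fun n => ((n : ℝ) + 1)⁻¹
  have ht : ∀ n, 0 < t n := fun n => by positivity
  have htlim : Tendsto t atTop (𝓝 0) := tendsto_inv_atTop_zero.comp
    (tendsto_atTop_add_const_right _ _ tendsto_natCast_atTop_atTop)
  let w : ℕ → V → ℝ := fun n ξ => Real.exp (-(t n * (2 * Real.pi * ‖ξ‖) ^ 2)) * U ξ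
  have hw0 : ∀ n ξ, 0 ≤ w n ξ := fun n ξ => mul_nonneg (Real.exp_pos _).le (hU0 ξ)
  have hwi : ∀ n, Integrable (w n) := fun n => by
    refine (integrable_exp_neg_norm_sq (ht n)).mul_bdd (c := (∫ y, ‖(u y : ℂ)‖) ^ 2)
      hc.aestronglyMeasurable (.of_forall fun ξ => ?_)
    rw [Real.norm_of_nonneg (hU0 ξ)]
    exact pow_le_pow_left₀ (norm_nonneg _) (norm_fourier_le_integral_norm _ ξ) 2
  have hlim : ∀ ξ, Tendsto (fun n => ENNReal.ofReal (w n ξ)) atTop (𝓝 (ENNReal.ofReal (U ξ))) := by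
    intro ξ
    refine ENNReal.tendsto_ofReal ?_
    have h := ((htlim.mul_const ((2 * Real.pi * ‖ξ‖) ^ 2)).neg.rexp).mul_const (U ξ)
    simpa using h
  have hle : ∫⁻ ξ, ENNReal.ofReal (U ξ) ≤ ENNReal.ofReal (∫ x, u x ^ 2) := by
    calc ∫⁻ ξ, ENNReal.ofReal (U ξ)
        = ∫⁻ ξ, liminf (fun n => ENNReal.ofReal (w n ξ)) atTop :=
          lintegral_congr fun ξ => (hlim ξ).liminf_eq.symm
      _ ≤ liminf (fun n => ∫⁻ ξ, ENNReal.ofReal (w n ξ)) atTop :=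
          lintegral_liminf_le fun n => by
            have := hc.measurable
            fun_prop
      _ ≤ ENNReal.ofReal (∫ x, u x ^ 2) := by
          refine liminf_le_of_frequently_le' (Frequently.of_forall fun n => ?_)
          rw [← ofReal_integral_eq_lintegral_ofReal (hwi n) (.of_forall (hw0 n))]
          exact ENNReal.ofReal_le_ofReal (integral_exp_mul_norm_fourier_sq_le hu hu2 (ht n))
  have hUi : Integrable U := by
    refine ⟨hc.aestronglyMeasurable, ?_⟩
    rw [hasFiniteIntegral_iff_ofReal (.of_forall hU0)]
    exact hle.trans_lt ENNReal.ofReal_lt_top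
  refine ⟨hUi, ?_⟩
  rw [← ofReal_integral_eq_lintegral_ofReal hUi (.of_forall hU0)] at hle
  exact (ENNReal.ofReal_le_ofReal_iff (integral_nonneg fun x => sq_nonneg _)).1 hle

/-- A pointwise convexity inequality integrates to a comparison of heat-semigroup forms. -/
lemma integral_one_sub_exp_mul_norm_fourier_sq_le {g h f : V → ℝ} {q : ℝ}
    (hg : Integrable g) (hg2 : Integrable fun x => g x ^ 2) (hh : Integrable h)
    (hf : Integrable f) (hfc : Continuous f) (hf' : Integrable (𝓕 fun y => (f y : ℂ)))
    (hhf : Integrable fun x => h x * f x)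
    (H : ∀ x y, g x * (g x - g y) ≤ q * (h x * (f x - f y))) {t : ℝ} (ht : 0 < t) :
    ∫ ξ, (1 - Real.exp (-(t * (2 * Real.pi * ‖ξ‖) ^ 2))) * ‖𝓕 (fun y => (g y : ℂ)) ξ‖ ^ 2
      ≤ ∫ ξ, (1 - Real.exp (-(t * (2 * Real.pi * ‖ξ‖) ^ 2))) *
        (q * (𝓕 (fun y => (f y : ℂ)) ξ * (starRingEnd ℂ) (𝓕 (fun y => (h y : ℂ)) ξ)).re) := by
  obtain ⟨k, C, hkc, hk0, hkC, hk, hk1, hmk⟩ := exists_heat_kernel (V := V) ht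
  obtain ⟨hgi, hgle⟩ := integrable_norm_fourier_sq hg hg2
  have hexp := integrable_exp_neg_norm_sq (V := V) ht
  have hb : ∀ᵐ ξ : V, ‖Real.exp (-(t * (2 * Real.pi * ‖ξ‖) ^ 2))‖ ≤ 1 :=
    .of_forall fun ξ => (Real.norm_of_nonneg (Real.exp_pos _).le).trans_le
      (exp_neg_mul_sq_le_one ht.le _)
  have hP := (integrable_mul_star_fourier hf' hh).re
  have hgg := integral_mul_fourier_mul_star_fourier hexp hmk hg hg
  have hhh := integral_mul_fourier_mul_star_fourier hexp hmk hh hf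
  have hfh := integral_mul_re_fourierInv hf' hh
  have hfc' : Continuous fun y => (f y : ℂ) := by fun_prop
  rw [hfc'.fourierInv_fourier_eq hf.ofReal hf'] at hfh
  simp only [Complex.ofReal_re] at hfh
  have hre : ∀ ξ, (𝓕 (fun y => (h y : ℂ)) ξ * (starRingEnd ℂ) (𝓕 (fun y => (f y : ℂ)) ξ)).re
      = (𝓕 (fun y => (f y : ℂ)) ξ * (starRingEnd ℂ) (𝓕 (fun y => (h y : ℂ)) ξ)).re := by
    intro ξ
    simp only [Complex.mul_re, Complex.conj_re, Complex.conj_im]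
    ring
  simp only [hre] at hhh
  simp only [Complex.mul_conj, Complex.ofReal_re, Complex.normSq_eq_norm_sq] at hgg
  have hkg := integrable_kernel_mul_fst hk hg2
  have hkhf := integrable_kernel_mul_fst hk hhf
  have hkgg := integrable_kernel_mul_mul hkc hk0 hkC hg hg
  have hkh := integrable_kernel_mul_mul hkc hk0 hkC hh hf
  have hD := integral_mono (hkg.sub hkgg) ((hkhf.sub hkh).const_mul q) fun z => by
    have := mul_le_mul_of_nonneg_left (H z.1 z.2) (hk0 (z.1 - z.2))
    simp only [Pi.sub_apply]
    linarith
  simp only [Pi.sub_apply] at hD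
  rw [integral_sub hkg hkgg, integral_const_mul, integral_sub hkhf hkh,
    integral_kernel_mul_fst hk hk1 hg2, integral_kernel_mul_fst hk hk1 hhf, ← hgg, ← hhh,
    hfh] at hD
  have hmg := hgi.bdd_mul hexp.aestronglyMeasurable hb
  have hmP := hP.bdd_mul hexp.aestronglyMeasurable hb
  have hl : ∫ ξ, (1 - Real.exp (-(t * (2 * Real.pi * ‖ξ‖) ^ 2))) * ‖𝓕 (fun y => (g y : ℂ)) ξ‖ ^ 2
      = (∫ ξ, ‖𝓕 (fun y => (g y : ℂ)) ξ‖ ^ 2) - ∫ ξ,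
        Real.exp (-(t * (2 * Real.pi * ‖ξ‖) ^ 2)) * ‖𝓕 (fun y => (g y : ℂ)) ξ‖ ^ 2 := by
    rw [← integral_sub hgi hmg]
    simp only [sub_mul, one_mul]
  rw [hl]
  refine ((sub_le_sub_right hgle _).trans hD).trans_eq ?_
  simp only [← RCLike.re_eq_complex_re]
  rw [← integral_sub hP hmP, ← integral_const_mul]
  refine integral_congr_ae (.of_forall fun ξ => ?_)
  simp only
  ring

end Energy

section Powers

lemma abs_rpow_mul_sub_le {p : ℝ} (hp : 2 ≤ p) (a b : ℝ) :
    |a| ^ (p / 2) * (|a| ^ (p / 2) - |b| ^ (p / 2))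
      ≤ p / 2 * (|a| ^ (p - 2) * a * (a - b)) := by
  rcases eq_or_ne a 0 with rfl | ha
  · simp [Real.zero_rpow (show p / 2 ≠ 0 by positivity)]
  have hA : 0 < |a| := abs_pos.2 ha
  obtain ⟨q, rfl⟩ : ∃ q, p = 2 * q := ⟨p / 2, by ring⟩
  rw [mul_div_cancel_left₀ q two_ne_zero]
  have hbern : |a| ^ q + q * |a| ^ (q - 1) * (|b| - |a|) ≤ |b| ^ q := by
    have h := one_add_mul_self_le_rpow_one_add (s := |b| / |a| - 1)
      (by linarith [div_nonneg (abs_nonneg b) hA.le]) (p := q) (by linarith)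
    rw [add_sub_cancel, Real.div_rpow (abs_nonneg b) hA.le, le_div_iff₀ (by positivity)] at h
    refine le_trans (le_of_eq ?_) h
    rw [Real.rpow_sub_one hA.ne']
    field_simp
  have hpow : |a| ^ (2 * q - 2) * |a| = |a| ^ q * |a| ^ (q - 1) := by
    rw [← Real.rpow_add_one hA.ne', ← Real.rpow_add hA]
    ring_nf
  have hab : |a| * (|a| - |b|) ≤ a * (a - b) := by
    have h1 := le_abs_self (a * b)
    rw [abs_mul] at h1
    nlinarith [abs_mul_abs_self a]
  calc |a| ^ q * (|a| ^ q - |b| ^ q)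
      ≤ |a| ^ q * (q * |a| ^ (q - 1) * (|a| - |b|)) := by gcongr; linarith
    _ = q * (|a| ^ (2 * q - 2) * (|a| * (|a| - |b|))) := by
        rw [← mul_assoc (|a| ^ (2 * q - 2)), hpow]
        ring
    _ ≤ q * (|a| ^ (2 * q - 2) * (a * (a - b))) := by gcongr; linarith
    _ = _ := by ring

lemma Real.rpow_le_one_add {x s : ℝ} (hx : 0 ≤ x) (hs : s ∈ Set.Icc (0 : ℝ) 1) :
    x ^ s ≤ 1 + x := by
  rcases le_total x 1 with h | h
  · linarith [Real.rpow_le_one hx h hs.1]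
  · have := Real.rpow_le_rpow_of_exponent_le h hs.2
    rw [Real.rpow_one] at this
    linarith

variable {X : Type*} [MeasurableSpace X] {μ : Measure X} {φ : X → ℝ} {C : ℝ}

lemma integrable_abs_rpow_mul (hφ : Integrable φ μ) (hC : ∀ x, |φ x| ≤ C) {r : ℝ} (hr : 0 ≤ r) :
    Integrable (fun x => |φ x| ^ r * φ x) μ := by
  refine hφ.bdd_mul (c := C ^ r) ?_ (.of_forall fun x => ?_)
  · exact ((Real.continuous_rpow_const hr).comp continuous_abs).comp_aestronglyMeasurable hφ.1
  · rw [Real.norm_of_nonneg (by positivity)]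
    exact Real.rpow_le_rpow (abs_nonneg _) (hC x) hr

lemma integrable_abs_rpow (hφ : Integrable φ μ) (hC : ∀ x, |φ x| ≤ C) {r : ℝ} (hr : 1 ≤ r) :
    Integrable (fun x => |φ x| ^ r) μ := by
  refine (integrable_abs_rpow_mul hφ.abs (C := C) (by simpa using hC)
    (sub_nonneg.2 hr)).congr (.of_forall fun x => ?_)
  rcases eq_or_ne (φ x) 0 with h | h
  · simp [h, Real.zero_rpow (show r ≠ 0 by positivity)]
  · simp only [abs_abs]
    rw [← Real.rpow_add_one (abs_ne_zero.2 h), sub_add_cancel]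

end Powers

lemma SchwartzMap.integrable_rpow_norm_mul {V : Type*} [NormedAddCommGroup V] [NormedSpace ℝ V]
    [MeasurableSpace V] [BorelSpace V] [SecondCountableTopology V] {μ : Measure V}
    [μ.HasTemperateGrowth] (F : SchwartzMap V ℂ) (c : ℝ) {s : ℝ} (hs : s ∈ Set.Icc (0 : ℝ) 1) :
    Integrable (fun ξ => ((((c * ‖ξ‖) ^ 2) ^ s : ℝ) : ℂ) * F ξ) μ := by
  have hF := F.continuous
  have hm : Measurable fun ξ : V => ((((c * ‖ξ‖) ^ 2) ^ s : ℝ) : ℂ) := by fun_prop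
  refine Integrable.mono' (F.integrable.norm.add ((F.integrable_pow_mul μ 2).const_mul (c ^ 2)))
    (hm.aestronglyMeasurable.mul hF.aestronglyMeasurable) (.of_forall fun ξ => ?_)
  rw [norm_mul, Complex.norm_real, Real.norm_of_nonneg (by positivity)]
  calc ((c * ‖ξ‖) ^ 2) ^ s * ‖F ξ‖ ≤ (1 + (c * ‖ξ‖) ^ 2) * ‖F ξ‖ := by
        gcongr
        exact Real.rpow_le_one_add (sq_nonneg _) hs
    _ = _ := by simp only [Pi.add_apply]; ring

/-- Córdoba–Córdoba-type positivity inequality: for `s ∈ [0,1]`, `p ∈ [2,∞)` and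
`f` Schwartz on `ℝ²`,
`∫ |f|^{p-2} f (-Δ)^s f ≥ (2/p) ∫ (2π|ξ|)^{2s} |𝓕(|f|^{p/2})(ξ)|² dξ`,
where `(-Δ)^s f = 𝓕⁻¹((2π|ξ|)^{2s} 𝓕f)`. -/
theorem cordoba_cordoba_positivity
    (s : ℝ) (hs : s ∈ Set.Icc (0 : ℝ) 1) (p : ℝ) (hp : 2 ≤ p)
    (f : SchwartzMap (EuclideanSpace ℝ (Fin 2)) ℝ) :
    (2 / p) * ∫ ξ : EuclideanSpace ℝ (Fin 2),
        (2 * Real.pi * ‖ξ‖) ^ (2 * s)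
          * ‖𝓕 (fun y : EuclideanSpace ℝ (Fin 2) => ((|f y| ^ (p / 2) : ℝ) : ℂ)) ξ‖ ^ 2
      ≤ ∫ x : EuclideanSpace ℝ (Fin 2),
          |f x| ^ (p - 2) * f x *
            (𝓕⁻ (fun ξ : EuclideanSpace ℝ (Fin 2) =>
              (((2 * Real.pi * ‖ξ‖) ^ (2 * s) : ℝ) : ℂ)
                * 𝓕 (fun y : EuclideanSpace ℝ (Fin 2) => ((f y : ℝ) : ℂ)) ξ) x).re := by
  obtain ⟨C, hC⟩ : ∃ C, ∀ x, |f x| ≤ C :=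
    ⟨_, fun x => f.toBoundedContinuousFunction.norm_coe_le_norm x⟩
  have hf : Integrable f := f.integrable
  have hfc : Continuous f := f.continuous
  let F : SchwartzMap (EuclideanSpace ℝ (Fin 2)) ℂ := 𝓕 (f.postcompCLM Complex.ofRealCLM)
  have hF : 𝓕 (fun y => (f y : ℂ)) = F := rfl
  have hg : Integrable fun x => |f x| ^ (p / 2) := integrable_abs_rpow hf hC (by linarith)
  have hg2 : Integrable fun x => (|f x| ^ (p / 2)) ^ 2 := by
    refine (integrable_abs_rpow hf hC (r := p) (by linarith)).congr (.of_forall fun x => ?_)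
    simp only
    rw [← Real.rpow_mul_natCast (abs_nonneg _)]
    norm_num
  have hh : Integrable fun x => |f x| ^ (p - 2) * f x :=
    integrable_abs_rpow_mul hf hC (by linarith)
  have hhf : Integrable fun x => |f x| ^ (p - 2) * f x * f x :=
    hh.mul_bdd hfc.aestronglyMeasurable (.of_forall hC)
  have hfI : Integrable (𝓕 fun y => (f y : ℂ)) := hF ▸ F.integrable
  have hsymb : ∀ ξ : EuclideanSpace ℝ (Fin 2),
      (2 * Real.pi * ‖ξ‖) ^ (2 * s) = ((2 * Real.pi * ‖ξ‖) ^ 2) ^ s := fun ξ => by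
    have := Real.pi_pos
    rw [Real.rpow_mul (by positivity), Real.rpow_two]
  have hwf : Integrable fun ξ => ((((2 * Real.pi * ‖ξ‖) ^ 2) ^ s : ℝ) : ℂ) *
      𝓕 (fun y => (f y : ℂ)) ξ := by
    simpa only [hF] using F.integrable_rpow_norm_mul (2 * Real.pi) hs
  simp only [hsymb]
  rw [integral_mul_re_fourierInv hwf hh]
  have hG₂ : ∀ ξ, ((2 * Real.pi * ‖ξ‖) ^ 2) ^ s * (p / 2 * (𝓕 (fun y => (f y : ℂ)) ξ *
      (starRingEnd ℂ) (𝓕 (fun y => ((|f y| ^ (p - 2) * f y : ℝ) : ℂ)) ξ)).re)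
      = p / 2 * (((((2 * Real.pi * ‖ξ‖) ^ 2) ^ s : ℝ) : ℂ) * 𝓕 (fun y => (f y : ℂ)) ξ *
      (starRingEnd ℂ) (𝓕 (fun y => ((|f y| ^ (p - 2) * f y : ℝ) : ℂ)) ξ)).re := fun ξ => by
    rw [mul_assoc ((_ : ℝ) : ℂ), Complex.re_ofReal_mul]
    ring
  have hmain := integral_rpow_mul_le_of_one_sub_exp (μ := volume) hs
    (l := fun ξ : EuclideanSpace ℝ (Fin 2) => (2 * Real.pi * ‖ξ‖) ^ 2)
    (G₁ := fun ξ => ‖𝓕 (fun y => ((|f y| ^ (p / 2) : ℝ) : ℂ)) ξ‖ ^ 2)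
    (G₂ := fun ξ => p / 2 * (𝓕 (fun y => (f y : ℂ)) ξ *
      (starRingEnd ℂ) (𝓕 (fun y => ((|f y| ^ (p - 2) * f y : ℝ) : ℂ)) ξ)).re)
    (by fun_prop) (fun ξ => sq_nonneg _) ?_
    ((continuous_fourier_of_integrable hg.ofReal).norm.pow 2).aestronglyMeasurable
    (fun ξ => sq_nonneg _) ((integrable_mul_star_fourier hfI hh).re.const_mul _).1 ?_
    (fun t ht => integral_one_sub_exp_mul_norm_fourier_sq_le hg hg2 hh hf hfc hfI hhf
      (fun x y => abs_rpow_mul_sub_le hp (f x) (f y)) ht)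
  · simp only [hG₂, integral_const_mul] at hmain
    calc _ ≤ 2 / p * (p / 2 * _) := mul_le_mul_of_nonneg_left hmain (by positivity)
      _ = _ := by
        rw [← mul_assoc, div_mul_div_cancel₀ (by positivity), div_self two_ne_zero, one_mul]
  · filter_upwards [compl_mem_ae_iff.2 (measure_singleton (0 : EuclideanSpace ℝ (Fin 2)))]
      with ξ hξ
    have := Real.pi_pos
    have := norm_pos_iff.2 hξ
    positivity
  · simp only [hG₂]
    exact (integrable_mul_star_fourier hwf hh).re.const_mul _
end
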